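/- arXiv:1111.5561 — 2 statements merged into one kernel-verified Lean document; each statement's English description precedes it below -/
import Mathlib

section
/- Let f be a homeomorphism of the torus T² homotopic to a Dehn twist, with lift f̂ to the vertical cylinder A. There exists M > 0 (depending only on f̂) with the following property: if there are points ẑ₁, ẑ₂ ∈ A and positive integers n₁, n₂ such that p₂(f̂^{n₁}(ẑ₁)) − p₂(ẑ₁) < −M and p₂(f̂^{n₂}(ẑ₂)) − p₂(ẑ₂) > M, then 0 is an interior point of the vertical rotation set ρ_V(f̂), i.e., [−ε, ε] ⊆ ρ_V(f̂) for some ε > 0. -/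
noncomputable section

open MeasureTheory

abbrev Torus := AddCircle (1 : ℝ) × AddCircle (1 : ℝ)
abbrev Cyl := AddCircle (1 : ℝ) × ℝ

/-- The covering map from the plane to the vertical cylinder. -/
def projCyl (z : ℝ × ℝ) : Cyl := ((z.1 : AddCircle (1 : ℝ)), z.2)

/-- The covering map from the plane to the torus. -/
def projTorus (z : ℝ × ℝ) : Torus := ((z.1 : AddCircle (1 : ℝ)), (z.2 : AddCircle (1 : ℝ)))

/-- A lift to the plane of a torus homeomorphism homotopic to a Dehn twist:
a homeomorphism of the plane commuting with integer horizontal translations and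
satisfying the Dehn-twist relation for vertical translations, with twist
coefficient `k > 0`. -/
structure DehnLift where
  F : (ℝ × ℝ) ≃ₜ (ℝ × ℝ)
  k : ℤ
  k_pos : 0 < k
  horiz : ∀ x y : ℝ, F (x + 1, y) = F (x, y) + (1, 0)
  vert : ∀ x y : ℝ, F (x, y + 1) = F (x, y) + ((k : ℝ), 1)

/-- The vertical rotation set of a cylinder map:
`ρ_V(f̂) = ∩_{i≥1} closure( ∪_{n≥i} { (p₂(f̂ⁿ(ẑ)) − p₂(ẑ))/n : ẑ ∈ A } )`. -/
def rotSet (fhat : Cyl → Cyl) : Set ℝ :=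
  ⋂ i : ℕ, closure (⋃ n : ℕ, ⋃ _ : i + 1 ≤ n,
    {r : ℝ | ∃ z : Cyl, r = ((fhat^[n] z).2 - z.2) / n})

/-- A subset of the cylinder is bounded iff its second-coordinate projection is
a bounded subset of `ℝ`. -/
def VBounded (S : Set Cyl) : Prop := ∃ M : ℝ, ∀ z ∈ S, |z.2| ≤ M

/-- `B⁻ = {ẑ : f̂ⁿ(ẑ) ∈ H⁻ for all n ≥ 0}` where `H⁻ = (ℝ/ℤ)×(−∞,0]`. -/
def Bminus (fhat : Cyl → Cyl) : Set Cyl := {z | ∀ n : ℕ, (fhat^[n] z).2 ≤ 0}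

/-- `B⁺ = {ẑ : f̂ⁿ(ẑ) ∈ H⁺ for all n ≥ 0}` where `H⁺ = (ℝ/ℤ)×[0,∞)`. -/
def Bplus (fhat : Cyl → Cyl) : Set Cyl := {z | ∀ n : ℕ, 0 ≤ (fhat^[n] z).2}

/-- `B_S⁻`: the union of the unbounded connected components of `B⁻`. -/
def BS (fhat : Cyl → Cyl) : Set Cyl :=
  {z | z ∈ Bminus fhat ∧ ¬ VBounded (connectedComponentIn (Bminus fhat) z)}

/-- `B_N⁺`: the union of the unbounded connected components of `B⁺`. -/
def BN (fhat : Cyl → Cyl) : Set Cyl :=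
  {z | z ∈ Bplus fhat ∧ ¬ VBounded (connectedComponentIn (Bplus fhat) z)}

/-- The ω-limit set `ω(S) = ∩_{n≥0} closure(∪_{i≥n} f̂ⁱ(S))`. -/
def omegaSet (fhat : Cyl → Cyl) (S : Set Cyl) : Set Cyl :=
  ⋂ n : ℕ, closure (⋃ i : ℕ, ⋃ _ : n ≤ i, fhat^[i] '' S)

section Helpers

lemma sin_stay (u : ℝ → ℝ) (hu : Continuous u) (hs : ∀ t, 0 ≤ Real.sin (u t)) :
    ∃ n : ℤ, ∀ t, 2 * Real.pi * n ≤ u t ∧ u t ≤ 2 * Real.pi * n + Real.pi := by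
  have hpi := Real.pi_pos
  have hno : ∀ (m : ℤ) (t : ℝ), u t ≠ 2 * Real.pi * m - Real.pi / 2 := by
    intro m t h
    have h1 := hs t
    rw [h, show 2 * Real.pi * (m:ℝ) - Real.pi / 2 = -(Real.pi / 2) + m * (2 * Real.pi) by ring,
      Real.sin_add_int_mul_two_pi, Real.sin_neg, Real.sin_pi_div_two] at h1
    linarith
  set n : ℤ := ⌊(u 0 + Real.pi / 2) / (2 * Real.pi)⌋ with hn
  have h0 : 2 * Real.pi * n - Real.pi / 2 ≤ u 0 := by
    have := Int.floor_le ((u 0 + Real.pi / 2) / (2 * Real.pi))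
    rw [← hn, le_div_iff₀ (by positivity)] at this
    linarith
  have h1 : u 0 < 2 * Real.pi * n + 3 * Real.pi / 2 := by
    have := Int.lt_floor_add_one ((u 0 + Real.pi / 2) / (2 * Real.pi))
    rw [← hn, div_lt_iff₀ (by positivity)] at this
    linarith
  refine ⟨n, fun t => ?_⟩
  have h2 : 2 * Real.pi * n - Real.pi / 2 < u t := by
    by_contra hc
    push Not at hc
    obtain ⟨x, hx⟩ := mem_range_of_exists_le_of_exists_ge hu ⟨t, hc⟩ ⟨0, h0⟩
    exact hno n x hx
  have h3 : u t < 2 * Real.pi * n + 3 * Real.pi / 2 := by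
    by_contra hc
    push Not at hc
    obtain ⟨x, hx⟩ := mem_range_of_exists_le_of_exists_ge hu ⟨0, h1.le⟩ ⟨t, hc⟩
    refine hno (n+1) x ?_
    rw [hx]; push_cast; ring
  have h4 := hs t
  have h5 : Real.sin (u t) = Real.sin (u t - 2 * Real.pi * n) := by
    rw [show u t - 2 * Real.pi * n = u t - n * (2 * Real.pi) by ring, Real.sin_sub_int_mul_two_pi]
  rw [h5] at h4
  constructor
  · by_contra hc
    push Not at hc
    have := Real.sin_neg_of_neg_of_neg_pi_lt (x := u t - 2 * Real.pi * n) (by linarith) (by linarith)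
    linarith
  · by_contra hc
    push Not at hc
    have := Real.sin_pos_of_pos_of_lt_pi (x := u t - 2 * Real.pi * n - Real.pi) (by linarith) (by linarith)
    rw [Real.sin_sub_pi] at this
    linarith

lemma crossing_basic (L K : ℝ → ℝ × ℝ) (hL : Continuous L) (hK : Continuous K)
    (h0 : ∀ t, (L 0).2 ≤ (K t).2) (h1 : ∀ t, (K t).2 ≤ (L 1).2)
    (h2 : ∀ s, (K 0).1 ≤ (L s).1) (h3 : ∀ s, (L s).1 ≤ (K 1).1) :
    ∃ s t, L s = K t := by
  by_contra hc
  push Not at hc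
  let g : C(ℝ × ℝ, ℂ) := ⟨fun p => ⟨(K p.2).1 - (L p.1).1, (K p.2).2 - (L p.1).2⟩, by
    have : (fun p : ℝ × ℝ => (⟨(K p.2).1 - (L p.1).1, (K p.2).2 - (L p.1).2⟩ : ℂ)) =
      fun p => (((K p.2).1 - (L p.1).1 : ℝ) : ℂ) + (((K p.2).2 - (L p.1).2 : ℝ) : ℂ) * Complex.I := by
      funext p
      apply Complex.ext <;> simp
    rw [this]
    fun_prop⟩
  have hg : ∀ p, g p ∈ ({0}ᶜ : Set ℂ) := by
    intro p h
    have h : g p = 0 := h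
    have ha : (K p.2).1 - (L p.1).1 = 0 := congrArg Complex.re h
    have hb : (K p.2).2 - (L p.1).2 = 0 := congrArg Complex.im h
    exact hc p.1 p.2 (Prod.ext (by linarith) (by linarith))
  obtain ⟨θ, ⟨-, hθ⟩, -⟩ := Complex.isCoveringMapOn_exp.existsUnique_continuousMap_lifts g
    (a₀ := (0,0)) (e₀ := Complex.log (g (0,0))) (Complex.exp_log (hg _)) hg
  have hθ' : ∀ p, Complex.exp (θ p) = g p := fun p => congrFun hθ p
  have hre : ∀ p : ℝ × ℝ, (K p.2).1 - (L p.1).1 = Real.exp (θ p).re * Real.cos (θ p).im := by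
    intro p
    rw [← Complex.exp_re, hθ']; rfl
  have him : ∀ p : ℝ × ℝ, (K p.2).2 - (L p.1).2 = Real.exp (θ p).re * Real.sin (θ p).im := by
    intro p
    rw [← Complex.exp_im, hθ']; rfl
  have hpi := Real.pi_pos
  obtain ⟨n, hn⟩ := sin_stay (fun t => (θ (0,t)).im) (by fun_prop) (by
    intro t
    have := him (0,t)
    have h := h0 t
    by_contra hneg
    push Not at hneg
    have := mul_neg_of_pos_of_neg (Real.exp_pos (θ (0,t)).re) hneg
    simp at *
    linarith)
  obtain ⟨m, hm⟩ := sin_stay (fun s => (θ (s,1)).im + Real.pi/2) (by fun_prop) (by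
    intro t
    rw [Real.sin_add_pi_div_two]
    have := hre (t,1)
    have h := h3 t
    by_contra hneg
    push Not at hneg
    have := mul_neg_of_pos_of_neg (Real.exp_pos (θ (t,1)).re) hneg
    simp at *
    linarith)
  obtain ⟨l, hl⟩ := sin_stay (fun t => (θ (1,t)).im + Real.pi) (by fun_prop) (by
    intro t
    rw [Real.sin_add_pi]
    have := him (1,t)
    have h := h1 t
    by_contra hneg
    push Not at hneg
    have := mul_pos (Real.exp_pos (θ (1,t)).re) (show 0 < Real.sin (θ (1,t)).im by linarith)
    simp at *
    linarith)
  obtain ⟨r, hr⟩ := sin_stay (fun s => (θ (s,0)).im - Real.pi/2) (by fun_prop) (by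
    intro t
    rw [Real.sin_sub_pi_div_two]
    have := hre (t,0)
    have h := h2 t
    by_contra hneg
    push Not at hneg
    have := mul_pos (Real.exp_pos (θ (t,0)).re) (show 0 < Real.cos (θ (t,0)).im by linarith)
    simp at *
    linarith)
  have key : ∀ a b : ℤ, Real.pi * a < Real.pi * b → a < b := by
    intro a b h
    exact_mod_cast lt_of_mul_lt_mul_left h hpi.le
  have a1 := hn 0; have a2 := hn 1; have b1 := hm 0; have b2 := hm 1
  have c1 := hl 0; have c2 := hl 1; have d1 := hr 0; have d2 := hr 1
  have e1 := key (n-1) m (by push_cast; linarith)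
  have e2 : m < n + 1 := key _ _ (by push_cast; linarith)
  have e3 : m < l + 1 := key _ _ (by push_cast; linarith)
  have e4 : l < m + 1 := key _ _ (by push_cast; linarith)
  have e5 : r < l := key _ _ (by push_cast; linarith)
  have e6 : l < r + 2 := key _ _ (by push_cast; linarith)
  have e7 : r < n + 1:= key _ _ (by push_cast; linarith)
  have e8 : n < r + 1:= key _ _ (by push_cast; linarith)
  omega

lemma joined_seg_v (x y y' : ℝ) (E : Set (ℝ × ℝ)) (h : ∀ s, min y y' ≤ s → s ≤ max y y' → (x, s) ∈ E) :
    JoinedIn E (x, y) (x, y') := by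
  refine JoinedIn.ofLine (f := fun t => (x, y + t * (y' - y))) (by fun_prop) (by simp) (by simp) ?_
  rintro _ ⟨t, ⟨ht0, ht1⟩, rfl⟩
  apply h
  · rcases le_total y y' with hy | hy
    · rw [min_eq_left hy]; nlinarith
    · rw [min_eq_right hy]; nlinarith
  · rcases le_total y y' with hy | hy
    · rw [max_eq_right hy]; nlinarith
    · rw [max_eq_left hy]; nlinarith

lemma joined_seg_h (x x' y : ℝ) (E : Set (ℝ × ℝ)) (h : ∀ s, min x x' ≤ s → s ≤ max x x' → (s, y) ∈ E) :
    JoinedIn E (x, y) (x', y) := by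
  refine JoinedIn.ofLine (f := fun t => (x + t * (x' - x), y)) (by fun_prop) (by simp) (by simp) ?_
  rintro _ ⟨t, ⟨ht0, ht1⟩, rfl⟩
  apply h
  · rcases le_total x x' with hy | hy
    · rw [min_eq_left hy]; nlinarith
    · rw [min_eq_right hy]; nlinarith
  · rcases le_total x x' with hy | hy
    · rw [max_eq_right hy]; nlinarith
    · rw [max_eq_left hy]; nlinarith

lemma path_bdd {a b : ℝ × ℝ} (γ : Path a b) : ∃ X : ℝ, ∀ t, |(γ t).1| ≤ X ∧ |(γ t).2| ≤ X := by
  have hc : IsCompact (Set.range γ) := isCompact_range γ.continuous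
  obtain ⟨X, hX⟩ := hc.isBounded.exists_norm_le
  refine ⟨X, fun t => ?_⟩
  have := hX (γ t) ⟨t, rfl⟩
  exact ⟨(norm_fst_le (γ t)).trans this, (norm_snd_le (γ t)).trans this⟩

/-- A vertical-ish line and a horizontal-ish line in the plane intersect. -/
lemma crossing {A B : Set (ℝ × ℝ)} {a b c d : ℝ × ℝ} (hA : JoinedIn A a b) (hB : JoinedIn B c d) :
    ∃ p : ℝ × ℝ, (p ∈ A ∨ (p.1 = a.1 ∧ p.2 ≤ a.2) ∨ (p.1 = b.1 ∧ b.2 ≤ p.2)) ∧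
      (p ∈ B ∨ (p.2 = c.2 ∧ p.1 ≤ c.1) ∨ (p.2 = d.2 ∧ d.1 ≤ p.1)) := by
  obtain ⟨γ, hγ⟩ := hA
  obtain ⟨κ, hκ⟩ := hB
  obtain ⟨X1, hX1⟩ := path_bdd γ
  obtain ⟨X2, hX2⟩ := path_bdd κ
  set X := max X1 X2
  have hX1' : ∀ t, |(γ t).1| ≤ X ∧ |(γ t).2| ≤ X := fun t =>
    ⟨(hX1 t).1.trans (le_max_left _ _), (hX1 t).2.trans (le_max_left _ _)⟩
  have hX2' : ∀ t, |(κ t).1| ≤ X ∧ |(κ t).2| ≤ X := fun t =>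
    ⟨(hX2 t).1.trans (le_max_right _ _), (hX2 t).2.trans (le_max_right _ _)⟩
  have ha : |a.1| ≤ X ∧ |a.2| ≤ X := by simpa using hX1' 0
  have hb : |b.1| ≤ X ∧ |b.2| ≤ X := by simpa using hX1' 1
  have hc : |c.1| ≤ X ∧ |c.2| ≤ X := by simpa using hX2' 0
  have hd : |d.1| ≤ X ∧ |d.2| ≤ X := by simpa using hX2' 1
  simp only [abs_le] at ha hb hc hd hX1' hX2'
  set A' : Set (ℝ × ℝ) := {p | (p ∈ A ∨ (p.1 = a.1 ∧ p.2 ≤ a.2) ∨ (p.1 = b.1 ∧ b.2 ≤ p.2)) ∧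
    -X ≤ p.1 ∧ p.1 ≤ X}
  set B' : Set (ℝ × ℝ) := {p | (p ∈ B ∨ (p.2 = c.2 ∧ p.1 ≤ c.1) ∨ (p.2 = d.2 ∧ d.1 ≤ p.1)) ∧
    -X ≤ p.2 ∧ p.2 ≤ X}
  have hA' : JoinedIn A' (a.1, -X) (b.1, X) := by
    refine JoinedIn.trans (y := a) ?_ (JoinedIn.trans (y := b) ?_ ?_)
    · refine joined_seg_v a.1 (-X) a.2 _ ?_
      intro s h1 h2
      rw [max_eq_right ha.2.1] at h2
      exact ⟨Or.inr (Or.inl ⟨rfl, h2⟩), ha.1⟩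
    · exact ⟨γ, fun t => ⟨Or.inl (hγ t), (hX1' t).1⟩⟩
    · refine joined_seg_v b.1 b.2 X _ ?_
      intro s h1 h2
      rw [min_eq_left hb.2.2] at h1
      exact ⟨Or.inr (Or.inr ⟨rfl, h1⟩), hb.1⟩
  have hB' : JoinedIn B' (-X, c.2) (X, d.2) := by
    refine JoinedIn.trans (y := c) ?_ (JoinedIn.trans (y := d) ?_ ?_)
    · refine joined_seg_h (-X) c.1 c.2 _ ?_
      intro s h1 h2
      rw [max_eq_right hc.1.1] at h2
      exact ⟨Or.inr (Or.inl ⟨rfl, h2⟩), hc.2⟩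
    · exact ⟨κ, fun t => ⟨Or.inl (hκ t), (hX2' t).2⟩⟩
    · refine joined_seg_h d.1 X d.2 _ ?_
      intro s h1 h2
      rw [min_eq_left hd.1.2] at h1
      exact ⟨Or.inr (Or.inr ⟨rfl, h1⟩), hd.2⟩
  obtain ⟨γ', hγ'⟩ := hA'
  obtain ⟨κ', hκ'⟩ := hB'
  have e1 : ∀ s, γ'.extend s ∈ A' := fun s => by
    have : γ'.extend s ∈ Set.range γ' := by rw [← γ'.extend_range]; exact ⟨s, rfl⟩
    obtain ⟨t, ht⟩ := this
    rw [← ht]; exact hγ' t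
  have e2 : ∀ s, κ'.extend s ∈ B' := fun s => by
    have : κ'.extend s ∈ Set.range κ' := by rw [← κ'.extend_range]; exact ⟨s, rfl⟩
    obtain ⟨t, ht⟩ := this
    rw [← ht]; exact hκ' t
  obtain ⟨s, t, hst⟩ := crossing_basic γ'.extend κ'.extend γ'.continuous_extend κ'.continuous_extend
    (fun t => by simpa using (e2 t).2.1) (fun t => by simpa using (e2 t).2.2)
    (fun t => by simpa using (e1 t).2.1) (fun t => by simpa using (e1 t).2.2)
  exact ⟨γ'.extend s, (e1 s).1, hst ▸ (e2 t).1⟩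

/-- Invariance under the unit horizontal translation. -/
def SInv (E : Set (ℝ × ℝ)) : Prop := ∀ p : ℝ × ℝ, p ∈ E ↔ p + (1, 0) ∈ E

lemma SInv.int {E : Set (ℝ × ℝ)} (h : SInv E) (p : ℝ × ℝ) (j : ℤ) :
    p + ((j : ℝ), 0) ∈ E ↔ p ∈ E := by
  induction j using Int.induction_on generalizing p with
  | zero => simp [show ((0:ℝ),(0:ℝ)) = 0 from rfl]
  | succ i ih =>
    rw [← ih p, h (p + (((i:ℤ):ℝ), 0))]
    push_cast
    rw [show p + ((i:ℝ) + 1, 0) = p + ((i:ℝ), 0) + (1, 0) by ext <;> simp; ring]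
  | pred i ih =>
    rw [← ih p, h (p + (_, 0))]
    push_cast
    rw [show p + (-(i:ℝ) - 1, 0) + (1, 0) = p + (-(i:ℝ), 0) by ext <;> simp <;> ring]

lemma exists_fund (p : ℝ × ℝ) : ∃ j : ℤ, 0 ≤ (p + ((j : ℝ), 0)).1 ∧ (p + ((j : ℝ), 0)).1 ≤ 1 := by
  refine ⟨-⌊p.1⌋, ?_, ?_⟩
  · simp [Int.floor_le]
  · have := Int.lt_floor_add_one p.1
    simp; linarith

lemma SInv.inter {A B : Set (ℝ × ℝ)} (hA : SInv A) (hB : SInv B) : SInv (A ∩ B) := fun p => by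
  simp only [Set.mem_inter_iff]; rw [hA p, hB p]
lemma SInv.union {A B : Set (ℝ × ℝ)} (hA : SInv A) (hB : SInv B) : SInv (A ∪ B) := fun p => by
  simp only [Set.mem_union]; rw [hA p, hB p]
lemma SInv.compl {A : Set (ℝ × ℝ)} (hA : SInv A) : SInv Aᶜ := fun p => by
  simp only [Set.mem_compl_iff]; rw [hA p]
lemma SInv.diff {A B : Set (ℝ × ℝ)} (hA : SInv A) (hB : SInv B) : SInv (A \ B) :=
  hA.inter hB.compl
lemma SInv.empty : SInv ∅ := fun p => by simp
lemma SInv.le (b : ℝ) : SInv {p | p.2 ≤ b} := fun p => by simp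
lemma SInv.iInter {E : ℕ → Set (ℝ × ℝ)} (h : ∀ n, SInv (E n)) : SInv (⋂ n, E n) := fun p => by
  simp only [Set.mem_iInter]
  exact forall_congr' fun n => h n p

lemma SInv.eq_preimage {A : Set (ℝ × ℝ)} (hA : SInv A) :
    (Homeomorph.addRight ((1:ℝ),(0:ℝ))) ⁻¹' A = A := by
  ext p; simp [(hA p).symm]

lemma SInv.closure {A : Set (ℝ × ℝ)} (hA : SInv A) : SInv (closure A) := fun p => by
  have := (Homeomorph.addRight ((1:ℝ),(0:ℝ))).preimage_closure A
  rw [hA.eq_preimage] at this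
  nth_rewrite 1 [← this]
  rfl

lemma SInv.frontier {A : Set (ℝ × ℝ)} (hA : SInv A) : SInv (frontier A) := fun p => by
  have := (Homeomorph.addRight ((1:ℝ),(0:ℝ))).preimage_frontier A
  rw [hA.eq_preimage] at this
  nth_rewrite 1 [← this]
  rfl

/-- Compactness modulo the translation. -/
lemma comp_mod (E : ℕ → Set (ℝ × ℝ)) (a b : ℝ) (hanti : ∀ n, E (n+1) ⊆ E n)
    (hcl : ∀ n, IsClosed (E n)) (hS : ∀ n, SInv (E n)) (hne : ∀ n, (E n).Nonempty)
    (ha : ∀ n, ∀ p ∈ E n, a ≤ p.2) (hb : ∀ n, ∀ p ∈ E n, p.2 ≤ b) : (⋂ n, E n).Nonempty := by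
  have hco : IsCompact (Set.Icc ((0:ℝ), a) (1, b)) := isCompact_Icc
  have := IsCompact.nonempty_iInter_of_sequence_nonempty_isCompact_isClosed
    (fun n => E n ∩ Set.Icc ((0:ℝ), a) (1, b))
    (fun n => Set.inter_subset_inter_left _ (hanti n))
    (fun n => by
      obtain ⟨p, hp⟩ := hne n
      obtain ⟨j, hj0, hj1⟩ := exists_fund p
      have hq := ((hS n).int p j).2 hp
      exact ⟨_, hq, ⟨hj0, ha n _ hq⟩, ⟨hj1, hb n _ hq⟩⟩)
    (hco.inter_left (hcl 0))
    (fun n => (hcl n).inter isClosed_Icc)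
  obtain ⟨p, hp⟩ := this
  exact ⟨p, Set.mem_iInter.2 fun n => (Set.mem_iInter.1 hp n).1⟩

def Adm (K V : Set (ℝ × ℝ)) : Prop :=
  IsOpen V ∧ SInv V ∧ (∃ b : ℝ, ∀ p ∈ V, p.2 ≤ b) ∧ ∀ p ∈ frontier V, p ∉ K

def PP (E : Set (ℝ × ℝ)) : Prop := ∀ V, Adm E V → ∀ p ∈ V, p ∉ E

def core (K : Set (ℝ × ℝ)) : Set (ℝ × ℝ) := {p | p ∈ K ∧ ∀ V, Adm K V → p ∉ V}

lemma Adm.empty (K : Set (ℝ × ℝ)) : Adm K ∅ :=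
  ⟨isOpen_empty, SInv.empty, ⟨0, by simp⟩, by simp⟩

lemma Adm.mono {K K' V : Set (ℝ × ℝ)} (h : Adm K V) (hK : K' ⊆ K) : Adm K' V :=
  ⟨h.1, h.2.1, h.2.2.1, fun p hp hk => h.2.2.2 p hp (hK hk)⟩

lemma Adm.union {K V V' : Set (ℝ × ℝ)} (h : Adm K V) (h' : Adm K V') : Adm K (V ∪ V') := by
  obtain ⟨a1, a2, ⟨b, hb⟩, a4⟩ := h
  obtain ⟨a1', a2', ⟨b', hb'⟩, a4'⟩ := h'
  refine ⟨a1.union a1', a2.union a2', ⟨max b b', ?_⟩, ?_⟩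
  · rintro p (hp | hp)
    · exact (hb p hp).trans (le_max_left _ _)
    · exact (hb' p hp).trans (le_max_right _ _)
  · intro p hp
    rcases frontier_union_subset V V' hp with h | h
    · exact a4 p h.1
    · exact a4' p h.2

lemma core_subset (K : Set (ℝ × ℝ)) : core K ⊆ K := fun _ h => h.1

lemma core_closed {K : Set (ℝ × ℝ)} (hK : IsClosed K) : IsClosed (core K) := by
  have : core K = K ∩ ⋂ V ∈ {V | Adm K V}, Vᶜ := by
    ext p; simp [core]
  rw [this]
  exact hK.inter (isClosed_biInter fun V hV => hV.1.isClosed_compl)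

lemma core_SInv {K : Set (ℝ × ℝ)} (hK : SInv K) : SInv (core K) := fun p => by
  simp only [core, Set.mem_ofPred_eq]
  rw [← hK p]
  refine and_congr_right fun _ => forall_congr' fun V => forall_congr' fun hV => ?_
  rw [← hV.2.1 p]

lemma cover_adm {K E : Set (ℝ × ℝ)} (hE : IsClosed E) (hES : SInv E) {a b : ℝ}
    (ha : ∀ p ∈ E, a ≤ p.2) (hb : ∀ p ∈ E, p.2 ≤ b)
    (hcov : ∀ p ∈ E, ∃ V, Adm K V ∧ p ∈ V) : ∃ V, Adm K V ∧ E ⊆ V := by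
  have hco : IsCompact (E ∩ Set.Icc ((0:ℝ), a) (1, b)) := isCompact_Icc.inter_left hE
  have : ∃ V, Adm K V ∧ (E ∩ Set.Icc ((0:ℝ), a) (1, b)) ⊆ V := by
    refine hco.induction_on (p := fun s => ∃ V, Adm K V ∧ s ⊆ V) ⟨∅, Adm.empty K, le_rfl⟩ ?_ ?_ ?_
    · rintro s t hst ⟨V, hV, htV⟩
      exact ⟨V, hV, hst.trans htV⟩
    · rintro s t ⟨V, hV, hs⟩ ⟨V', hV', ht⟩
      exact ⟨V ∪ V', hV.union hV', Set.union_subset_union hs ht⟩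
    · intro p hp
      obtain ⟨V, hV, hpV⟩ := hcov p hp.1
      exact ⟨V, mem_nhdsWithin_of_mem_nhds (hV.1.mem_nhds hpV), V, hV, le_rfl⟩
  obtain ⟨V, hV, hsub⟩ := this
  refine ⟨V, hV, fun p hp => ?_⟩
  obtain ⟨j, hj0, hj1⟩ := exists_fund p
  have hq := (hES.int p j).2 hp
  exact (hV.2.1.int p j).1 (hsub ⟨hq, ⟨hj0, ha _ hq⟩, ⟨hj1, hb _ hq⟩⟩)

lemma frontier_le {V : Set (ℝ × ℝ)} {b : ℝ} (hb : ∀ p ∈ V, p.2 ≤ b) : ∀ p ∈ closure V, p.2 ≤ b := by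
  intro p hp
  have hc : IsClosed {p : ℝ × ℝ | p.2 ≤ b} := isClosed_le continuous_snd continuous_const
  exact closure_minimal (fun p hp => hb p hp) hc hp

lemma core_PP {K : Set (ℝ × ℝ)} (hK : IsClosed K) (hS : SInv K) (h0 : ∀ p ∈ K, 0 ≤ p.2) :
    PP (core K) := by
  rintro V ⟨V1, V2, ⟨b, hb⟩, V4⟩ p hpV hpc
  obtain ⟨V', hV', hsub⟩ := cover_adm (K := K) (E := frontier V ∩ K) (a := 0) (b := b)
    (isClosed_frontier.inter hK) (V2.frontier.inter hS) (fun p hp => h0 p hp.2)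
    (fun p hp => frontier_le hb p hp.1.1) (by
      rintro p ⟨hp, hpK⟩
      have := V4 p hp
      simp only [core, Set.mem_ofPred_eq, not_and, not_forall, not_not] at this
      obtain ⟨V', h1, h2⟩ := this hpK
      exact ⟨V', h1, h2⟩)
  have hadm : Adm K (V \ closure V') := by
    refine ⟨V1.sdiff isClosed_closure, V2.diff hV'.2.1.closure, ⟨b, fun p hp => hb p hp.1⟩, ?_⟩
    intro q hq hqK
    have hq1 : q ∈ closure (V \ closure V') := hq.1
    have hq2 : q ∉ V \ closure V' := by
      have := hq.2
      rwa [(V1.sdiff isClosed_closure).interior_eq] at this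
    have hq3 : q ∉ V' := by
      intro h
      obtain ⟨x, hx1, hx2⟩ := mem_closure_iff.1 hq1 V' hV'.1 h
      exact hx2.2 (subset_closure hx1)
    have hq4 : q ∈ closure V := closure_mono Set.sdiff_subset hq1
    by_cases hqV : q ∈ V
    · have : q ∈ closure V' := by
        by_contra hc
        exact hq2 ⟨hqV, hc⟩
      exact hV'.2.2.2 q ⟨this, by rwa [hV'.1.interior_eq]⟩ hqK
    · exact hq3 (hsub ⟨⟨hq4, by rwa [V1.interior_eq]⟩, hqK⟩)
  have h1 := hpc.2 _ hadm
  have h2 := hpc.2 _ hV'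
  have h3 : p ∈ closure V' := by
    by_contra hc
    exact h1 ⟨hpV, hc⟩
  exact hV'.2.2.2 p ⟨h3, by rwa [hV'.1.interior_eq]⟩ hpc.1

lemma subset_core {K E : Set (ℝ × ℝ)} (hE : E ⊆ K) (hP : PP E) : E ⊆ core K := fun p hp =>
  ⟨hE hp, fun V hV hpV => hP V (hV.mono hE) p hpV hp⟩

lemma SInv.preimage {E : Set (ℝ × ℝ)} (hE : SInv E) (G : ℝ × ℝ → ℝ × ℝ)
    (hG : ∀ p, G (p + (1,0)) = G p + (1,0)) : SInv (G ⁻¹' E) := fun p => by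
  simp only [Set.mem_preimage, hG]; exact hE _

lemma symm_comm (G : (ℝ × ℝ) ≃ₜ (ℝ × ℝ))
    (hG : ∀ p, G (p + (1,0)) = G p + (1,0)) (p : ℝ × ℝ) : G.symm (p + (1,0)) = G.symm p + (1,0) := by
  apply G.injective
  rw [hG]; simp

lemma SInv.image {E : Set (ℝ × ℝ)} (hE : SInv E) (G : (ℝ × ℝ) ≃ₜ (ℝ × ℝ))
    (hG : ∀ p, G (p + (1,0)) = G p + (1,0)) : SInv (G '' E) := by
  rw [show G '' E = G.symm ⁻¹' E from G.image_eq_preimage_symm E]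
  exact hE.preimage _ (symm_comm G hG)

lemma PP.image {E : Set (ℝ × ℝ)} (hE : PP E) (G : (ℝ × ℝ) ≃ₜ (ℝ × ℝ))
    (hG : ∀ p, G (p + (1,0)) = G p + (1,0)) (D : ℝ) (hD : ∀ p, |(G p).2 - p.2| ≤ D) :
    PP (G '' E) := by
  rintro V ⟨V1, V2, ⟨b, hb⟩, V4⟩ p hpV ⟨q, hq, rfl⟩
  refine hE (G ⁻¹' V) ⟨V1.preimage G.continuous, V2.preimage _ hG, ⟨b + D, ?_⟩, ?_⟩ q hpV hq
  · intro p hp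
    have := hb _ hp
    have := abs_le.1 (hD p)
    linarith
  · intro p hp hpE
    rw [← G.preimage_frontier] at hp
    exact V4 _ hp ⟨p, hpE, rfl⟩

lemma PP.iInter {E : ℕ → Set (ℝ × ℝ)} (hanti : ∀ n, E (n+1) ⊆ E n)
    (hcl : ∀ n, IsClosed (E n)) (hS : ∀ n, SInv (E n)) (h0 : ∀ n, ∀ p ∈ E n, 0 ≤ p.2)
    (hP : ∀ n, PP (E n)) : PP (⋂ n, E n) := by
  rintro V ⟨V1, V2, ⟨b, hb⟩, V4⟩ p hpV hpE
  by_cases h : ∀ n, (frontier V ∩ E n).Nonempty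
  · obtain ⟨q, hq⟩ := comp_mod (fun n => frontier V ∩ E n) 0 b
      (fun n => Set.inter_subset_inter_right _ (hanti n))
      (fun n => isClosed_frontier.inter (hcl n)) (fun n => V2.frontier.inter (hS n)) h
      (fun n p hp => h0 n p hp.2) (fun n p hp => frontier_le hb p hp.1.1)
    rw [Set.mem_iInter] at hq
    exact V4 q (hq 0).1 (Set.mem_iInter.2 fun n => (hq n).2)
  · push Not at h
    obtain ⟨n, hn⟩ := h
    refine hP n V ⟨V1, V2, ⟨b, hb⟩, ?_⟩ p hpV (Set.mem_iInter.1 hpE n)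
    intro q hq hqE
    exact (Set.eq_empty_iff_forall_notMem.1 hn) q ⟨hq, hqE⟩

/-- A twist map of the plane, with bounds. -/
structure Tw (F : (ℝ × ℝ) ≃ₜ (ℝ × ℝ)) (C : ℝ) (k : ℤ) : Prop where
  h : ∀ p, F (p + (1,0)) = F p + (1,0)
  v : ∀ p, F (p + (0,1)) = F p + ((k:ℝ),1)
  one_le : 1 ≤ C
  b2 : ∀ p, |(F p).2 - p.2| ≤ C
  b1 : ∀ p, |(F p).1 - p.1 - k * p.2| ≤ C

variable {F : (ℝ × ℝ) ≃ₜ (ℝ × ℝ)} {C : ℝ} {k : ℤ}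

lemma h_iter (hF : ∀ p, F (p + (1,0)) = F p + (1,0)) (n : ℕ) (p : ℝ × ℝ) :
    F^[n] (p + (1,0)) = F^[n] p + (1,0) := by
  induction n generalizing p with
  | zero => rfl
  | succ n ih => rw [Function.iterate_succ_apply, hF, ih, Function.iterate_succ_apply]

lemma v_iter (T : Tw F C k) (n : ℕ) (p : ℝ × ℝ) (N : ℤ) :
    (F^[n] (p + (0,(N:ℝ)))).2 = (F^[n] p).2 + N := by
  have hh : ∀ (p : ℝ × ℝ) (j : ℤ), F (p + ((j:ℝ),0)) = F p + ((j:ℝ),0) := by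
    intro p j
    induction j using Int.induction_on generalizing p with
    | zero => simp [show ((0:ℝ),(0:ℝ)) = 0 from rfl]
    | succ i ih =>
      push_cast at *
      rw [show p + ((i:ℝ) + 1, 0) = p + ((i:ℝ), 0) + (1, 0) by ext <;> simp; ring, T.h, ih]
      ext <;> simp; ring
    | pred i ih =>
      push_cast at *
      have := T.h (p + (-(i:ℝ) - 1, 0))
      rw [show p + (-(i:ℝ) - 1, 0) + (1, 0) = p + (-(i:ℝ), 0) by ext <;> simp <;> ring, ih] at this
      have h1 := congrArg Prod.fst this
      have h2 := congrArg Prod.snd this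
      simp at h1 h2
      ext
      · simp; linarith
      · simp; linarith
  have hv : ∀ (p : ℝ × ℝ) (j : ℤ), F (p + (0,(j:ℝ))) = F p + ((k:ℝ)*j,(j:ℝ)) := by
    intro p j
    induction j using Int.induction_on generalizing p with
    | zero => simp [show ((0:ℝ),(0:ℝ)) = 0 from rfl]
    | succ i ih =>
      push_cast at *
      rw [show p + (0,(i:ℝ) + 1) = p + (0,(i:ℝ)) + (0,1) by ext <;> simp; ring, T.v, ih]
      ext <;> simp <;> ring
    | pred i ih =>
      push_cast at *
      have := T.v (p + (0,-(i:ℝ) - 1))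
      rw [show p + (0,-(i:ℝ) - 1) + (0,1) = p + (0,-(i:ℝ)) by ext <;> simp <;> ring, ih] at this
      have h1 := congrArg Prod.fst this
      have h2 := congrArg Prod.snd this
      simp at h1 h2
      ext
      · simp; linarith
      · simp; linarith
  have main : ∀ n : ℕ, ∀ p : ℝ × ℝ, ∃ m : ℤ, F^[n] (p + (0,(N:ℝ))) = F^[n] p + ((m:ℝ),(N:ℝ)) := by
    intro n p
    induction n with
    | zero => exact ⟨0, by simp⟩
    | succ n ih =>
      obtain ⟨m, hm⟩ := ih
      refine ⟨m + k * N, ?_⟩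
      rw [Function.iterate_succ_apply', hm, Function.iterate_succ_apply']
      rw [show F^[n] p + ((m:ℝ),(N:ℝ)) = F^[n] p + (0,(N:ℝ)) + ((m:ℝ),0) by ext <;> simp, hh, hv]
      ext <;> simp; ring
  obtain ⟨m, hm⟩ := main n p
  rw [hm]; simp

lemma iter_lower (T : Tw F C k) (n : ℕ) (p : ℝ × ℝ) : p.2 - n * C ≤ (F^[n] p).2 := by
  induction n with
  | zero => simp
  | succ n ih =>
    rw [Function.iterate_succ_apply']
    have := abs_le.1 (T.b2 (F^[n] p))
    push_cast
    linarith

lemma preconn_frontier {X : Type*} [TopologicalSpace X] {A V : Set X} (hA : IsPreconnected A)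
    (hV : IsOpen V) (hf : ∀ p ∈ frontier V, p ∉ A) (hne : (A ∩ V).Nonempty) : A ⊆ V := by
  have h := hA.subset_or_subset hV isClosed_closure.isOpen_compl (v := (closure V)ᶜ)
    (Set.disjoint_left.2 fun p hp hc => hc (subset_closure hp)) (by
      intro p hp
      by_cases hpV : p ∈ V
      · exact Or.inl hpV
      · right
        intro hc
        exact hf p ⟨hc, by rwa [hV.interior_eq]⟩ hp)
  rcases h with h | h
  · exact h
  · obtain ⟨p, hp, hpV⟩ := hne
    exact absurd (subset_closure hpV) (h hp)

def Bset (F : (ℝ × ℝ) ≃ₜ (ℝ × ℝ)) : Set (ℝ × ℝ) := {p | ∀ n : ℕ, 0 ≤ (F^[n] p).2}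
def Kset (F : (ℝ × ℝ) ≃ₜ (ℝ × ℝ)) (n : ℕ) : Set (ℝ × ℝ) := {p | ∀ i ≤ n, 0 ≤ (F^[i] p).2}

lemma Kset_closed (n : ℕ) : IsClosed (Kset F n) := by
  have : Kset F n = ⋂ i ∈ Set.Iic n, {p | 0 ≤ (F^[i] p).2} := by
    ext p; simp [Kset]
  rw [this]
  exact isClosed_biInter fun i _ => isClosed_le continuous_const
    (continuous_snd.comp (F.continuous.iterate i))

lemma Kset_SInv (hF : ∀ p, F (p + (1,0)) = F p + (1,0)) (n : ℕ) : SInv (Kset F n) := fun p => by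
  simp [Kset, h_iter hF]

lemma Bset_eq : Bset F = ⋂ n, Kset F n := by
  ext p
  simp only [Bset, Kset, Set.mem_iInter, Set.mem_ofPred_eq]
  exact ⟨fun h n i _ => h i, fun h n => h n n le_rfl⟩

lemma Bset_closed : IsClosed (Bset F) := by
  rw [Bset_eq]; exact isClosed_iInter fun n => Kset_closed n

lemma Bset_SInv (hF : ∀ p, F (p + (1,0)) = F p + (1,0)) : SInv (Bset F) := by
  rw [Bset_eq]; exact SInv.iInter fun n => Kset_SInv hF n

lemma core_B_nonempty (T : Tw F C k) (hup : ∀ M : ℝ, ∃ (n : ℕ) (p : ℝ × ℝ), M < (F^[n] p).2 - p.2) :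
    (core (Bset F)).Nonempty := by
  have hC := T.one_le
  by_contra hne
  rw [Set.not_nonempty_iff_eq_empty] at hne
  set R := C + 1 with hR
  have hB0 : ∀ p ∈ Bset F, 0 ≤ p.2 := fun p hp => hp 0
  obtain ⟨V, hV, hsub⟩ := cover_adm (K := Bset F) (E := Bset F ∩ {p | p.2 ≤ R}) (a := 0) (b := R)
    (Bset_closed.inter (isClosed_le continuous_snd continuous_const))
    ((Bset_SInv T.h).inter (SInv.le R)) (fun p hp => hB0 p hp.1) (fun p hp => hp.2) (by
      intro p hp
      have : p ∉ core (Bset F) := by rw [hne]; simp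
      simp only [core, Set.mem_ofPred_eq, not_and, not_forall, not_not] at this
      obtain ⟨V', h1, h2⟩ := this hp.1
      exact ⟨V', h1, h2⟩)
  obtain ⟨b, hb⟩ := hV.2.2.1
  have hZ : ∃ n, ¬ ((frontier V ∩ Kset F n) ∪ ((Kset F n ∩ {p | p.2 ≤ R}) \ V)).Nonempty := by
    by_contra hc
    push Not at hc
    have hKm : ∀ n, Kset F (n+1) ⊆ Kset F n := fun n p hp i hi => hp i (by omega)
    obtain ⟨q, hq⟩ := comp_mod (fun n => (frontier V ∩ Kset F n) ∪ ((Kset F n ∩ {p | p.2 ≤ R}) \ V))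
      0 (max b R) (fun n => by
        rintro p (⟨h1, h2⟩ | ⟨⟨h1, h2⟩, h3⟩)
        · exact Or.inl ⟨h1, hKm n h2⟩
        · exact Or.inr ⟨⟨hKm n h1, h2⟩, h3⟩)
      (fun n => (isClosed_frontier.inter (Kset_closed n)).union
        (((Kset_closed n).inter (isClosed_le continuous_snd continuous_const)).sdiff hV.1))
      (fun n => (hV.2.1.frontier.inter (Kset_SInv T.h n)).union
        (((Kset_SInv T.h n).inter (SInv.le R)).diff hV.2.1)) hc
      (by
        rintro n p (⟨h1, h2⟩ | ⟨⟨h1, h2⟩, h3⟩)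
        · exact h2 0 (Nat.zero_le _)
        · exact h1 0 (Nat.zero_le _))
      (by
        rintro n p (⟨h1, h2⟩ | ⟨⟨h1, h2⟩, h3⟩)
        · exact (frontier_le hb p h1.1).trans (le_max_left _ _)
        · exact le_trans h2 (le_max_right _ _))
    rw [Set.mem_iInter] at hq
    have hqB : q ∈ Bset F := by
      rw [Bset_eq, Set.mem_iInter]
      intro n
      rcases hq n with h | h
      · exact h.2
      · exact h.1.1
    rcases hq 0 with h | h
    · exact hV.2.2.2 q h.1 hqB
    · exact h.2 (hsub ⟨hqB, h.1.2⟩)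
  obtain ⟨n, hn⟩ := hZ
  rw [Set.not_nonempty_iff_eq_empty, Set.eq_empty_iff_forall_notMem] at hn
  set Top : Set (ℝ × ℝ) := {p | (n:ℝ) * C ≤ p.2} with hTop
  have hTc : IsPreconnected Top := by
    apply Convex.isPreconnected
    exact convex_halfSpace_ge (f := Prod.snd) (IsLinearMap.mk (by simp) (by simp)) _
  have hTK : Top ⊆ Kset F n := by
    intro p hp i hi
    have h1 := iter_lower T i p
    have h2 : (i:ℝ) * C ≤ n * C := by
      have : (i:ℝ) ≤ n := by exact_mod_cast hi
      nlinarith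
    have h3 : (n:ℝ) * C ≤ p.2 := hp
    linarith
  set x0 : ℝ × ℝ := (0, n * C) with hx0
  have hx0T : x0 ∈ Top := le_refl ((n:ℝ) * C)
  set O := connectedComponentIn (Kset F n) x0 with hO
  have hOc : IsPreconnected O := isPreconnected_connectedComponentIn
  have hTO : Top ⊆ O := hTc.subset_connectedComponentIn hx0T hTK
  have hOK : O ⊆ Kset F n := connectedComponentIn_subset _ _
  have hOV : ∀ p ∈ O, p ∉ V := by
    intro p hp hpV
    have := preconn_frontier hOc hV.1 (fun q hq hqO => hn q (Or.inl ⟨hq, hOK hqO⟩)) ⟨p, hp, hpV⟩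
    have h1 : ((0:ℝ), max ((n:ℝ) * C) (b+1)) ∈ O := hTO (le_max_left ((n:ℝ) * C) (b+1))
    have h2 := hb _ (this h1)
    have h3 := le_max_right ((n:ℝ) * C) (b+1)
    simp only at h2
    linarith
  have hOR : ∀ p ∈ O, R < p.2 := by
    intro p hp
    by_contra hc
    push Not at hc
    exact hn p (Or.inr ⟨⟨hOK hp, hc⟩, hOV p hp⟩)
  have hFO : ∀ p, F p ∈ O → p ∈ O := by
    have hc1 : IsPreconnected (F ⁻¹' O) := by
      rw [← F.image_symm]
      exact hOc.image _ F.symm.continuous.continuousOn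
    have hy : F.symm (0, (n+1) * C) ∈ Top := by
      have := abs_le.1 (T.b2 (F.symm (0, (n+1) * C)))
      simp only [F.apply_symm_apply] at this
      simp only [hTop, Set.mem_ofPred_eq]
      linarith
    have hc2 : F ⁻¹' O ⊆ Kset F n := by
      intro p hp i hi
      rcases i with _ | i
      · have h1 := hOR _ hp
        have h2 := abs_le.1 (T.b2 p)
        simp only [Function.iterate_zero, id]
        linarith
      · rw [Function.iterate_succ_apply]
        exact hOK hp i (by omega)
    have hyO : F.symm (0, (n+1) * C) ∈ F ⁻¹' O := by
      simp only [Set.mem_preimage, F.apply_symm_apply]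
      apply hTO
      simp only [hTop, Set.mem_ofPred_eq]
      linarith
    have h := hc1.subset_connectedComponentIn hyO hc2
    rw [← connectedComponentIn_eq (hTO hy)] at h
    exact h
  have hFO' : ∀ (m : ℕ) p, F^[m] p ∈ O → p ∈ O := by
    intro m
    induction m with
    | zero => intro p h; exact h
    | succ m ih =>
      intro p h
      rw [Function.iterate_succ_apply] at h
      exact hFO p (ih _ h)
  obtain ⟨m, p, hmp⟩ := hup (n * C + 1)
  set N : ℤ := ⌈n * C - (F^[m] p).2⌉ with hN
  have hN1 : n * C - (F^[m] p).2 ≤ N := Int.le_ceil _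
  have hN2 : (N:ℝ) < n * C - (F^[m] p).2 + 1 := Int.ceil_lt_add_one _
  have h1 := v_iter T m p N
  have h2 : F^[m] (p + (0,(N:ℝ))) ∈ O := by
    apply hTO
    simp only [hTop, Set.mem_ofPred_eq]
    linarith
  have h3 := hOK (hFO' m _ h2) 0 (Nat.zero_le _)
  simp at h3
  linarith

lemma lemmaA (T : Tw F C k) (hup : ∀ M : ℝ, ∃ (n : ℕ) (p : ℝ × ℝ), M < (F^[n] p).2 - p.2) :
    (∃ (n : ℕ) (w : ℝ × ℝ), ∀ j : ℕ, (j:ℝ) ≤ (F^[j * n] w).2) ∨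
    ∃ Q : Set (ℝ × ℝ), Q.Nonempty ∧ IsClosed Q ∧ SInv Q ∧ PP Q ∧ F '' Q = Q ∧ ∀ p ∈ Q, 0 ≤ p.2 := by
  have hWne := core_B_nonempty T hup
  set W := core (Bset F) with hW
  have hB0 : ∀ p ∈ Bset F, 0 ≤ p.2 := fun p hp => hp 0
  have hBF : ∀ p ∈ Bset F, F p ∈ Bset F := fun p hp n => by
    have := hp (n+1)
    rwa [Function.iterate_succ_apply] at this
  have hWcl : IsClosed W := core_closed Bset_closed
  have hWS : SInv W := core_SInv (Bset_SInv T.h)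
  have hWP : PP W := core_PP Bset_closed (Bset_SInv T.h) hB0
  have hWB : W ⊆ Bset F := core_subset _
  have hFW : F '' W ⊆ W := by
    apply subset_core
    · rintro _ ⟨p, hp, rfl⟩
      exact hBF p (hWB hp)
    · exact hWP.image F T.h C T.b2
  set E : ℕ → Set (ℝ × ℝ) := fun n => F^[n] '' W with hE
  have hE0 : E 0 = W := by simp [hE]
  have hEs : ∀ n, E (n+1) = F '' (E n) := by
    intro n
    simp only [hE]
    rw [Function.iterate_succ', Set.image_comp]
  have hanti : ∀ n, E (n+1) ⊆ E n := by
    intro n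
    induction n with
    | zero => rw [hEs, hE0]; exact hFW
    | succ n ih =>
      have h := Set.image_mono (f := F) ih
      rwa [← hEs (n+1), ← hEs n] at h
  have hcl : ∀ n, IsClosed (E n) := by
    intro n
    induction n with
    | zero => rw [hE0]; exact hWcl
    | succ n ih => rw [hEs]; exact F.isClosed_image.2 ih
  have hS : ∀ n, SInv (E n) := by
    intro n
    induction n with
    | zero => rw [hE0]; exact hWS
    | succ n ih => rw [hEs]; exact ih.image F T.h
  have hP : ∀ n, PP (E n) := by
    intro n
    induction n with
    | zero => rw [hE0]; exact hWP
    | succ n ih => rw [hEs]; exact ih.image F T.h C T.b2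
  have hEW : ∀ n, E n ⊆ W := by
    intro n
    induction n with
    | zero => rw [hE0]
    | succ n ih => exact (hanti n).trans ih
  have h0 : ∀ n, ∀ p ∈ E n, 0 ≤ p.2 := fun n p hp => hB0 p (hWB (hEW n hp))
  by_cases hQ : (⋂ n, E n).Nonempty
  · right
    refine ⟨⋂ n, E n, hQ, isClosed_iInter hcl, SInv.iInter hS, PP.iInter hanti hcl hS h0 hP, ?_, ?_⟩
    · rw [Set.image_iInter F.bijective]
      apply Set.Subset.antisymm
      · intro p hp
        rw [Set.mem_iInter] at hp ⊢
        intro n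
        apply hanti
        rw [hEs]; exact hp n
      · intro p hp
        rw [Set.mem_iInter] at hp ⊢
        intro n
        rw [← hEs]; exact hp (n+1)
    · intro p hp
      exact h0 0 p (Set.mem_iInter.1 hp 0)
  · left
    have : ∃ n, ¬ (E n ∩ {p | p.2 ≤ 1}).Nonempty := by
      by_contra hc
      push Not at hc
      obtain ⟨q, hq⟩ := comp_mod (fun n => E n ∩ {p | p.2 ≤ 1}) 0 1
        (fun n => Set.inter_subset_inter_left _ (hanti n))
        (fun n => (hcl n).inter (isClosed_le continuous_snd continuous_const))
        (fun n => (hS n).inter (SInv.le 1)) hc (fun n p hp => h0 n p hp.1) (fun n p hp => hp.2)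
      rw [Set.mem_iInter] at hq
      exact hQ ⟨q, Set.mem_iInter.2 fun n => (hq n).1⟩
    obtain ⟨n, hn⟩ := this
    have hn1 : ∀ w ∈ W, 1 < (F^[n] w).2 := by
      intro w hw
      by_contra hc
      push Not at hc
      exact hn ⟨_, ⟨w, hw, rfl⟩, hc⟩
    have hFit : ∀ m : ℕ, ∀ w ∈ W, F^[m] w ∈ W := fun m w hw => hEW m ⟨w, hw, rfl⟩
    have hφ : (Homeomorph.addRight ((0:ℝ), ((-1 : ℤ):ℝ))) '' (E n) ⊆ W := by
      apply subset_core
      · rintro _ ⟨_, ⟨w, hw, rfl⟩, rfl⟩ m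
        simp only [Homeomorph.coe_addRight]
        rw [v_iter T, ← Function.iterate_add_apply, add_comm m n, Function.iterate_add_apply]
        have := hn1 _ (hFit m w hw)
        push_cast
        linarith
      · refine (hP n).image _ (fun p => ?_) 1 (fun p => ?_)
        · simp only [Homeomorph.coe_addRight]; ring
        · simp
    obtain ⟨w, hw⟩ := hWne
    refine ⟨n, w, fun j => ?_⟩
    induction j generalizing w with
    | zero => simpa using hB0 w (hWB hw)
    | succ j ih =>
      have h1 := hφ ⟨_, ⟨w, hw, rfl⟩, rfl⟩
      have h2 := ih _ h1
      simp only [Homeomorph.coe_addRight] at h2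
      rw [v_iter T, ← Function.iterate_add_apply] at h2
      rw [show (j+1) * n = j * n + n by ring]
      push_cast at *
      linarith

lemma h_int (hF : ∀ p, F (p + (1,0)) = F p + (1,0)) (p : ℝ × ℝ) (j : ℤ) :
    F (p + ((j:ℝ),0)) = F p + ((j:ℝ),0) := by
  induction j using Int.induction_on generalizing p with
  | zero => simp [show ((0:ℝ),(0:ℝ)) = 0 from rfl]
  | succ i ih =>
    push_cast at *
    rw [show p + ((i:ℝ) + 1, 0) = p + ((i:ℝ), 0) + (1, 0) by ext <;> simp; ring, hF, ih]
    ext <;> simp; ring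
  | pred i ih =>
    push_cast at *
    have := hF (p + (-(i:ℝ) - 1, 0))
    rw [show p + (-(i:ℝ) - 1, 0) + (1, 0) = p + (-(i:ℝ), 0) by ext <;> simp; ring, ih] at this
    have h1 := congrArg Prod.fst this
    have h2 := congrArg Prod.snd this
    simp at h1 h2
    ext
    · simp; linarith
    · simp; linarith

lemma coe_circle_iff (x y : ℝ) : ((x : AddCircle (1:ℝ)) = (y : AddCircle (1:ℝ))) ↔ ∃ j : ℤ, x + j = y := by
  rw [QuotientAddGroup.eq, AddSubgroup.mem_zmultiples_iff]
  constructor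
  · rintro ⟨j, hj⟩
    refine ⟨j, ?_⟩
    simp at hj
    linarith
  · rintro ⟨j, hj⟩
    refine ⟨j, ?_⟩
    simp
    linarith

/-- union of all integer horizontal translates -/
def til (A : Set (ℝ × ℝ)) : Set (ℝ × ℝ) := {p | ∃ j : ℤ, p + ((j:ℝ),0) ∈ A}

lemma til_SInv (A : Set (ℝ × ℝ)) : SInv (til A) := fun p => by
  constructor
  · rintro ⟨j, hj⟩
    refine ⟨j - 1, ?_⟩
    push_cast
    rwa [show p + (1,0) + ((j:ℝ) - 1, 0) = p + ((j:ℝ),0) by ext <;> simp]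
  · rintro ⟨j, hj⟩
    refine ⟨j + 1, ?_⟩
    push_cast
    rwa [show p + ((j:ℝ) + 1, 0) = p + (1,0) + ((j:ℝ),0) by ext <;> simp; ring]

lemma til_closed {A : Set (ℝ × ℝ)} (hA : IsCompact A) : IsClosed (til A) := by
  set π : ℝ × ℝ → AddCircle (1:ℝ) × ℝ := fun p => ((p.1 : AddCircle (1:ℝ)), p.2) with hπ
  have hc : Continuous π := by
    refine Continuous.prodMk ?_ continuous_snd
    exact (AddCircle.continuous_mk' 1).comp continuous_fst
  have : til A = π ⁻¹' (π '' A) := by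
    ext p
    constructor
    · rintro ⟨j, hj⟩
      refine ⟨_, hj, ?_⟩
      simp only [hπ]
      ext
      · symm; exact (coe_circle_iff _ _).2 ⟨j, by simp⟩
      · simp
    · rintro ⟨a, ha, hap⟩
      have h1 := congrArg Prod.fst hap
      have h2 := congrArg Prod.snd hap
      obtain ⟨j, hj⟩ := (coe_circle_iff _ _).1 h1.symm
      refine ⟨j, ?_⟩
      simp only [hπ] at h2
      rwa [show p + ((j:ℝ),0) = a by ext <;> simp [hj, h2]]
  rw [this]
  exact (hA.image hc).isClosed.preimage hc

lemma ray_closed (x y : ℝ) : IsClosed (til {p : ℝ × ℝ | p.1 = x ∧ p.2 ≤ y}) := by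
  have : til {p : ℝ × ℝ | p.1 = x ∧ p.2 ≤ y} =
      (fun p : ℝ × ℝ => ((p.1 : AddCircle (1:ℝ)))) ⁻¹' {(x : AddCircle (1:ℝ))} ∩ {p | p.2 ≤ y} := by
    ext p
    simp [til, coe_circle_iff]
  rw [this]
  exact (isClosed_singleton.preimage ((AddCircle.continuous_mk' 1).comp continuous_fst)).inter
    (isClosed_le continuous_snd continuous_const)

lemma first_time (u : ℝ → ℝ) (hu : Continuous u) (h : ℝ) (h0 : u 0 < h) (t : ℝ) (ht : 0 ≤ t)
    (hut : h ≤ u t) : ∃ τ, 0 ≤ τ ∧ τ ≤ t ∧ u τ = h ∧ ∀ s, 0 ≤ s → s < τ → u s < h := by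
  have hco : IsCompact (Set.Icc 0 t ∩ {s | h ≤ u s}) :=
    isCompact_Icc.inter_right (isClosed_le continuous_const hu)
  obtain ⟨τ, hτ, hmin⟩ := hco.exists_isLeast ⟨t, ⟨ht, le_rfl⟩, hut⟩
  have hlt : ∀ s, 0 ≤ s → s < τ → u s < h := by
    intro s hs hsτ
    by_contra hc
    push Not at hc
    have := hmin ⟨⟨hs, hsτ.le.trans hτ.1.2⟩, hc⟩
    linarith
  refine ⟨τ, hτ.1.1, hτ.1.2, le_antisymm ?_ hτ.2, hlt⟩
  by_contra hc
  push Not at hc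
  obtain ⟨s, hs, hsh⟩ := intermediate_value_Icc hτ.1.1 hu.continuousOn ⟨h0.le, hc.le⟩
  have hsτ : s < τ := lt_of_le_of_ne hs.2 (by rintro rfl; linarith)
  have := hlt s hs.1 hsτ
  linarith

lemma joined_image {X : Type*} [TopologicalSpace X] (γ : ℝ → X) (hγ : Continuous γ) (s t : ℝ) (hst : s ≤ t) :
    JoinedIn (γ '' Set.Icc s t) (γ s) (γ t) := by
  have h : JoinedIn (Set.Icc s t) s t :=
    ((convex_Icc s t).isPathConnected ⟨s, le_rfl, hst⟩).joinedIn s ⟨le_rfl, hst⟩ t ⟨hst, le_rfl⟩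
  exact h.map hγ

lemma first_hit (γ : ℝ → ℝ × ℝ) (hγ : Continuous γ) (g : ℝ × ℝ → ℝ) (hg : Continuous g) (h : ℝ)
    (h0 : g (γ 0) < h) (t : ℝ) (ht : 0 ≤ t) (hut : h ≤ g (γ t)) :
    ∃ τ, 0 ≤ τ ∧ τ ≤ t ∧ g (γ τ) = h ∧
    ∀ p ∈ γ '' Set.Icc 0 τ, g p ≤ h ∧ (g p = h → p = γ τ) := by
  obtain ⟨τ, h1, h2, h3, h4⟩ := first_time (g ∘ γ) (hg.comp hγ) h h0 t ht hut
  refine ⟨τ, h1, h2, h3, ?_⟩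
  rintro _ ⟨s, hs, rfl⟩
  rcases hs.2.lt_or_eq with hlt | rfl
  · have := h4 s hs.1 hlt
    simp only [Function.comp] at this
    exact ⟨this.le, fun h => by linarith⟩
  · exact ⟨h3.le, fun _ => rfl⟩

lemma pp_path {Q X : Set (ℝ × ℝ)} (hP : PP Q) (hX : IsClosed X) (hXS : SInv X) (hd : ∀ p ∈ Q, p ∉ X)
    {q : ℝ × ℝ} (hq : q ∈ Q) (H : ℝ) : ∃ z, H ≤ z.2 ∧ JoinedIn Xᶜ q z := by
  by_contra hc
  push Not at hc
  set V : Set (ℝ × ℝ) := {p | ∃ j : ℤ, JoinedIn Xᶜ q (p + ((j:ℝ),0))} with hV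
  have hball : ∀ p ∉ X, ∃ r > 0, ∀ p' ∈ Metric.ball p r, p' ∈ V ↔ p ∈ V := by
    intro p hp
    obtain ⟨r, hr, hsub⟩ := Metric.isOpen_iff.1 hX.isOpen_compl p hp
    refine ⟨r, hr, fun p' hp' => ?_⟩
    have hJ : JoinedIn Xᶜ p p' := by
      have := ((convex_ball p r).isPathConnected ⟨p, Metric.mem_ball_self hr⟩).joinedIn p
        (Metric.mem_ball_self hr) p' hp'
      exact this.mono hsub
    have hJj : ∀ j : ℤ, JoinedIn Xᶜ (p + ((j:ℝ),0)) (p' + ((j:ℝ),0)) := by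
      intro j
      have h1 := hJ.map (f := fun x => x + ((j:ℝ),(0:ℝ))) (by fun_prop)
      refine h1.mono ?_
      rintro _ ⟨x, hx, rfl⟩
      exact (hXS.compl.int x j).2 hx
    constructor
    · rintro ⟨j, hj⟩
      exact ⟨j, hj.trans (hJj j).symm⟩
    · rintro ⟨j, hj⟩
      exact ⟨j, hj.trans (hJj j)⟩
  have hVX : ∀ p ∈ V, p ∉ X := by
    rintro p ⟨j, hj⟩
    exact (hXS.compl.int p j).1 hj.target_mem
  have hVo : IsOpen V := by
    rw [Metric.isOpen_iff]
    intro p hp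
    obtain ⟨r, hr, h⟩ := hball p (hVX p hp)
    exact ⟨r, hr, fun p' hp' => (h p' hp').2 hp⟩
  refine hP V ⟨hVo, ?_, ⟨H, ?_⟩, ?_⟩ q ⟨0, ?_⟩ hq
  · exact til_SInv {p | JoinedIn Xᶜ q p}
  · rintro p ⟨j, hj⟩
    by_contra hlt
    push Not at hlt
    exact hc _ (by simpa using hlt.le) hj
  · intro p hp hpQ
    obtain ⟨r, hr, h⟩ := hball p (hd p hpQ)
    obtain ⟨p', hp', hp'V⟩ := Metric.mem_closure_iff.1 hp.1 r hr
    have : p ∈ V := (h p' (by rwa [Metric.mem_ball, dist_comm])).1 hp'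
    exact hp.2 (by rwa [hVo.interior_eq])
  · have : q + (((0:ℤ):ℝ),0) = q := by ext <;> simp
    rw [this]
    exact JoinedIn.refl (hd q hq)

lemma exists_lowest {Q : Set (ℝ × ℝ)} (hne : Q.Nonempty) (hcl : IsClosed Q) (hS : SInv Q)
    (h0 : ∀ p ∈ Q, 0 ≤ p.2) : ∃ q ∈ Q, ∀ p ∈ Q, q.2 ≤ p.2 := by
  obtain ⟨p0, hp0⟩ := hne
  have hco : IsCompact (Q ∩ Set.Icc ((0:ℝ), 0) (1, p0.2)) := isCompact_Icc.inter_left hcl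
  have key : ∀ p ∈ Q, p.2 ≤ p0.2 → ∃ p' ∈ Q ∩ Set.Icc ((0:ℝ), 0) (1, p0.2), p'.2 = p.2 := by
    intro p hp hle
    obtain ⟨j, hj0, hj1⟩ := exists_fund p
    have hq := (hS.int p j).2 hp
    exact ⟨_, ⟨hq, ⟨hj0, h0 _ hq⟩, ⟨hj1, by simpa using hle⟩⟩, by simp⟩
  obtain ⟨p', hp', -⟩ := key p0 hp0 le_rfl
  obtain ⟨q, hq, hmin⟩ := hco.exists_isMinOn ⟨p', hp'⟩ (f := Prod.snd) continuous_snd.continuousOn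
  refine ⟨q, hq.1, fun p hp => ?_⟩
  rcases le_total p.2 p0.2 with hle | hle
  · obtain ⟨p'', h1, h2⟩ := key p hp hle
    rw [← h2]
    exact hmin h1
  · have : q.2 ≤ p0.2 := hq.2.2.2
    linarith

/-- Data: an arc from below, avoiding `Q`, staying below height `h` for two height functions,
first touching for `g`. -/
lemma arc_of_not_inv {Q : Set (ℝ × ℝ)} {y0 h Y : ℝ}
    (hy : ∀ p ∈ Q, y0 ≤ p.2) (hh : y0 < h) (hY : Y < y0)
    (G : (ℝ × ℝ) ≃ₜ (ℝ × ℝ)) (hGQ : ∀ p, G p ∈ Q → p ∈ Q) (hGY : ∀ p, p.2 ≤ Y → (G p).2 < y0)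
    (hex : ∃ p, (∃ a : ℝ × ℝ, a.2 < y0 ∧ JoinedIn {p | p ∉ Q ∧ p.2 < h} a p) ∧
      ¬ ∃ a : ℝ × ℝ, a.2 < y0 ∧ JoinedIn {p | p ∉ Q ∧ p.2 < h} a (G p)) :
    ∃ (A : Set (ℝ × ℝ)) (a v : ℝ × ℝ), IsCompact A ∧ JoinedIn A a v ∧ a.2 ≤ Y ∧
      (∀ p ∈ A, p ∉ Q ∧ p.2 < h ∧ (G p).2 ≤ h ∧ ((G p).2 = h → p = v)) ∧ (G v).2 = h := by
  obtain ⟨p, ⟨a0, ha0, hJ⟩, hnot⟩ := hex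
  set D : Set (ℝ × ℝ) := {p | p ∉ Q ∧ p.2 < h} with hD
  set a : ℝ × ℝ := (a0.1, min Y a0.2) with ha
  have hJ' : JoinedIn D a p := by
    refine JoinedIn.trans ?_ hJ
    refine joined_seg_v a0.1 (min Y a0.2) a0.2 _ ?_
    intro s _ hs2
    have : s ≤ a0.2 := by simpa using hs2
    refine ⟨fun hq => ?_, by simp only; linarith⟩
    have := hy _ hq
    simp only at this
    linarith
  have haY : a.2 ≤ Y := min_le_left _ _
  obtain ⟨γ, hγ⟩ := hJ'
  have hext : ∀ s, γ.extend s ∈ D := fun s => by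
    have : γ.extend s ∈ Set.range γ := by rw [← γ.extend_range]; exact ⟨s, rfl⟩
    obtain ⟨t, ht⟩ := this
    rw [← ht]; exact hγ t
  have hGa : (G a).2 < y0 := hGY a haY
  have hhit : ∃ t : unitInterval, h ≤ (G (γ t)).2 := by
    by_contra hc
    push Not at hc
    refine hnot ⟨G a, hGa, γ.map G.continuous, fun t => ⟨fun hq => ?_, hc t⟩⟩
    exact (hγ t).1 (hGQ _ hq)
  obtain ⟨t, ht⟩ := hhit
  obtain ⟨τ, h1, h2, h3, h4⟩ := first_hit γ.extend γ.continuous_extend (fun p => (G p).2)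
    (continuous_snd.comp G.continuous) h (by simp only [Path.extend_zero]; linarith) t t.2.1
    (by simpa using ht)
  refine ⟨γ.extend '' Set.Icc 0 τ, a, γ.extend τ, isCompact_Icc.image γ.continuous_extend, ?_, haY,
    ?_, h3⟩
  · have := joined_image γ.extend γ.continuous_extend 0 τ h1
    simpa using this
  · intro p hp
    have h5 := h4 p hp
    obtain ⟨s, -, rfl⟩ := hp
    exact ⟨(hext s).1, (hext s).2, h5.1, h5.2⟩

lemma exists_int_between (x y w : ℝ) (h : x < y - 1) : ∃ j : ℤ, x < w + j ∧ w + j < y := by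
  refine ⟨⌊x - w⌋ + 1, ?_, ?_⟩
  · have := Int.lt_floor_add_one (x - w)
    push_cast; linarith
  · have := Int.floor_le (x - w)
    push_cast; linarith

lemma joined_shift {A : Set (ℝ × ℝ)} {a b : ℝ × ℝ} (h : JoinedIn A a b) (j : ℤ) :
    JoinedIn ((fun x => x + ((j:ℝ),(0:ℝ))) '' A) (a + ((j:ℝ),0)) (b + ((j:ℝ),0)) :=
  h.map (f := fun x => x + ((j:ℝ),(0:ℝ))) (by fun_prop)

lemma not_til {A : Set (ℝ × ℝ)} {p x : ℝ × ℝ} {j : ℤ} (hx : x ∈ A) (hp : p = x + ((j:ℝ),0)) : p ∈ til A := by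
  refine ⟨-j, ?_⟩
  rw [hp, show x + ((j:ℝ),(0:ℝ)) + (((-j : ℤ):ℝ),0) = x by ext <;> simp]
  exact hx

lemma crossing_left_bound {A : Set (ℝ × ℝ)} (hA : IsCompact A) : ∃ X : ℝ, ∀ p ∈ A, X < p.1 := by
  obtain ⟨X, hX⟩ := hA.isBounded.exists_norm_le
  refine ⟨-X - 1, fun p hp => ?_⟩
  have := abs_le.1 ((norm_fst_le p).trans (hX p hp))
  linarith [this.1]

lemma S23b (T : Tw F C k) (hk : 0 < k) {h y0 : ℝ} (hh : C < h)
    {A : Set (ℝ × ℝ)} {a w : ℝ × ℝ} (hAc : IsCompact A) (hAJ : JoinedIn A a w)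
    (hA : ∀ p ∈ A, p.2 ≤ h ∧ (p.2 = h → p = w) ∧ (F p).2 < h) (hw : w.2 = h)
    (ha1 : a.2 < y0 - 1) (ha2 : a.2 < h - C)
    {E : Set (ℝ × ℝ)} {e f : ℝ × ℝ} (hEJ : JoinedIn E f e)
    (hE : ∀ p ∈ E, p.2 ≤ h ∧ (p.2 = h → p = e)) (he : e.2 = h) (hf : (F f).2 = h)
    (hEy : ∀ p ∈ E, y0 - 1 < p.2) (hEA : ∀ p ∈ E, p ∉ til A) :
    e.1 + k * h - C - 1 ≤ (F f).1 := by
  have hC := T.one_le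
  have hk' : (1:ℝ) ≤ k := by exact_mod_cast hk
  by_contra hc
  push Not at hc
  obtain ⟨j, hj1, hj2⟩ := exists_int_between ((F f).1 - k * h + C) e.1 w.1 (by linarith)
  obtain ⟨X0, hX0⟩ := crossing_left_bound (hAc.image (f := fun x => x + ((j:ℝ),(0:ℝ))) (by fun_prop))
  set X : ℝ := min (X0 - C - 1) (F f).1 with hX
  have hXX : X ≤ X0 - C - 1 := min_le_left _ _
  have hXf : X ≤ (F f).1 := min_le_right _ _
  set c0 := F.symm (X, h) with hc0
  have hFc0 : F c0 = (X, h) := by rw [hc0, F.apply_symm_apply]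
  have hc02 := abs_le.1 (T.b2 c0)
  have hc01 := abs_le.1 (T.b1 c0)
  rw [hFc0] at hc02 hc01
  simp only at hc02 hc01
  have hc0X : c0.1 < X0 := by nlinarith
  set G : Set (ℝ × ℝ) := {p | (F p).2 = h ∧ (F p).1 ≤ (F f).1} with hG
  have hGJ : JoinedIn G c0 f := by
    have h1 : JoinedIn {p : ℝ × ℝ | p.2 = h ∧ p.1 ≤ (F f).1} (X, h) ((F f).1, h) := by
      apply joined_seg_h
      intro s _ hs
      rw [max_eq_right hXf] at hs
      exact ⟨rfl, hs⟩
    have h2 := h1.map F.symm.continuous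
    have h3 : F.symm ((F f).1, h) = f := by
      rw [F.symm_apply_eq]; ext <;> simp [hf]
    rw [h3] at h2
    refine h2.mono ?_
    rintro _ ⟨x, hx, rfl⟩
    simpa [hG] using hx
  have hGb : ∀ p ∈ G, h - C ≤ p.2 := by
    intro p hp
    have := abs_le.1 (T.b2 p)
    have := hp.1
    linarith
  have hBJ : JoinedIn (G ∪ E) c0 e :=
    (hGJ.mono Set.subset_union_left).trans (hEJ.mono Set.subset_union_right)
  obtain ⟨p, hp1, hp2⟩ := crossing (joined_shift hAJ j) hBJ
  simp only [Prod.fst_add, Prod.snd_add, add_zero] at hp1 hp2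
  have hb : w + ((j:ℝ),0) ∈ (fun x => x + ((j:ℝ),(0:ℝ))) '' A := ⟨w, hAJ.target_mem, rfl⟩
  have hwX := hX0 _ hb
  simp only [Prod.fst_add] at hwX
  rcases hp1 with hpA | ⟨hpx, hpy⟩ | ⟨hpx, hpy⟩
  · obtain ⟨x, hx, hxp⟩ := hpA
    have hxp' : p = x + ((j:ℝ),0) := hxp.symm
    have e1 : p.1 = x.1 + j := by rw [hxp']; simp
    have e2 : p.2 = x.2 := by rw [hxp']; simp
    obtain ⟨u1, u2, u3⟩ := hA x hx
    rcases hp2 with (hpG | hpE) | ⟨hqy, hqx⟩ | ⟨hqy, hqx⟩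
    · have := hpG.1
      rw [hxp', h_int T.h] at this
      simp at this
      linarith
    · exact hEA p hpE (not_til hx hxp')
    · have := hX0 p ⟨x, hx, hxp⟩
      linarith
    · have := u2 (by linarith)
      rw [this] at e1
      linarith
  · rcases hp2 with (hpG | hpE) | ⟨hqy, hqx⟩ | ⟨hqy, hqx⟩
    · have := hGb p hpG
      linarith
    · have := hEy p hpE
      linarith
    · linarith
    · linarith
  · rcases hp2 with (hpG | hpE) | ⟨hqy, hqx⟩ | ⟨hqy, hqx⟩
    · have h1 := hpG.2
      have h2 := abs_le.1 (T.b1 p)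
      have h3 : (k:ℝ) * h ≤ k * p.2 := by nlinarith
      linarith
    · obtain ⟨u1, u2⟩ := hE p hpE
      have := u2 (by linarith)
      rw [this] at hpx
      linarith
    · linarith
    · linarith

lemma S23a (T : Tw F C k) (hk : 0 < k) {h y0 : ℝ} (hh : C < h)
    {A : Set (ℝ × ℝ)} {a v : ℝ × ℝ} (hAc : IsCompact A) (hAJ : JoinedIn A a v)
    (hA : ∀ p ∈ A, p.2 < h ∧ (F p).2 ≤ h ∧ ((F p).2 = h → p = v)) (hv : (F v).2 = h)
    (ha1 : a.2 < y0 - 1) (ha2 : a.2 < h - C)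
    {E : Set (ℝ × ℝ)} {e f : ℝ × ℝ} (hEJ : JoinedIn E e f)
    (hE : ∀ p ∈ E, (F p).2 ≤ h ∧ ((F p).2 = h → p = f)) (he : e.2 = h) (hf : (F f).2 = h)
    (hEy : ∀ p ∈ E, y0 - 1 < p.2) (hEA : ∀ p ∈ E, p ∉ til A) :
    e.1 + k * h - C - 1 ≤ (F f).1 := by
  have hC := T.one_le
  have hk' : (1:ℝ) ≤ k := by exact_mod_cast hk
  by_contra hc
  push Not at hc
  obtain ⟨j, hj1, hj2⟩ := exists_int_between (F f).1 (e.1 + k * h - C) (F v).1 (by linarith)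
  set Z : Set (ℝ × ℝ) := F.symm '' (Set.Icc ((F v).1 + (j:ℝ), h) ((F v).1 + j, h + 3 * C)) with hZ
  have hZc : IsCompact Z := isCompact_Icc.image F.symm.continuous
  have hZm : ∀ p ∈ Z, (F p).1 = (F v).1 + j ∧ h ≤ (F p).2 := by
    rintro _ ⟨x, hx, rfl⟩
    rw [F.apply_symm_apply]
    exact ⟨le_antisymm hx.2.1 hx.1.1, hx.1.2⟩
  set A' : Set (ℝ × ℝ) := (fun x => x + ((j:ℝ),(0:ℝ))) '' A with hA'
  obtain ⟨X0, hX0⟩ := crossing_left_bound ((hAc.image (f := fun x => x + ((j:ℝ),(0:ℝ))) (by fun_prop)).union hZc)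
  set b := F.symm ((F v).1 + (j:ℝ), h + 3 * C) with hb
  have hFb : F b = ((F v).1 + (j:ℝ), h + 3 * C) := by rw [hb, F.apply_symm_apply]
  have hb2 := abs_le.1 (T.b2 b)
  rw [hFb] at hb2
  simp only at hb2
  have hZJ : JoinedIn Z (v + ((j:ℝ),0)) b := by
    have h1 : JoinedIn (Set.Icc ((F v).1 + (j:ℝ), h) ((F v).1 + j, h + 3 * C)) ((F v).1 + j, h) ((F v).1 + j, h + 3 * C) := by
      apply joined_seg_v
      intro s hs1 hs2
      rw [min_eq_left (by linarith)] at hs1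
      rw [max_eq_right (by linarith)] at hs2
      exact ⟨⟨le_rfl, hs1⟩, ⟨le_rfl, hs2⟩⟩
    have h2 := h1.map F.symm.continuous
    have h3 : F.symm ((F v).1 + (j:ℝ), h) = v + ((j:ℝ),0) := by
      rw [F.symm_apply_eq, h_int T.h]; ext <;> simp [hv]
    rwa [h3] at h2
  set X : ℝ := min (X0 - C - 1) (F f).1 with hX
  have hXX : X ≤ X0 - C - 1 := min_le_left _ _
  have hXf : X ≤ (F f).1 := min_le_right _ _
  set c0 := F.symm (X, h) with hc0
  have hFc0 : F c0 = (X, h) := by rw [hc0, F.apply_symm_apply]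
  have hc02 := abs_le.1 (T.b2 c0)
  have hc01 := abs_le.1 (T.b1 c0)
  rw [hFc0] at hc02 hc01
  simp only at hc02 hc01
  have hc0X : c0.1 < X0 := by nlinarith
  set G : Set (ℝ × ℝ) := {p | (F p).2 = h ∧ (F p).1 ≤ (F f).1} with hG
  have hGJ : JoinedIn G c0 f := by
    have h1 : JoinedIn {p : ℝ × ℝ | p.2 = h ∧ p.1 ≤ (F f).1} (X, h) ((F f).1, h) := by
      apply joined_seg_h
      intro s _ hs
      rw [max_eq_right hXf] at hs
      exact ⟨rfl, hs⟩
    have h2 := h1.map F.symm.continuous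
    have h3 : F.symm ((F f).1, h) = f := by
      rw [F.symm_apply_eq]; ext <;> simp [hf]
    rw [h3] at h2
    refine h2.mono ?_
    rintro _ ⟨x, hx, rfl⟩
    simpa [hG] using hx
  have hGb : ∀ p ∈ G, h - C ≤ p.2 ∧ p.2 ≤ h + C := by
    intro p hp
    have := abs_le.1 (T.b2 p)
    have := hp.1
    constructor <;> linarith
  have hBJ : JoinedIn (G ∪ E) c0 e :=
    (hGJ.mono Set.subset_union_left).trans (hEJ.symm.mono Set.subset_union_right)
  have hAJ' : JoinedIn (A' ∪ Z) (a + ((j:ℝ),0)) b :=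
    ((joined_shift hAJ j).mono Set.subset_union_left).trans (hZJ.mono Set.subset_union_right)
  obtain ⟨p, hp1, hp2⟩ := crossing hAJ' hBJ
  simp only [Prod.fst_add, Prod.snd_add, add_zero] at hp1 hp2
  rcases hp1 with (hpA | hpZ) | ⟨hpx, hpy⟩ | ⟨hpx, hpy⟩
  · obtain ⟨x, hx, hxp⟩ := hpA
    have hxp' : p = x + ((j:ℝ),0) := hxp.symm
    have e1 : p.1 = x.1 + j := by rw [hxp']; simp
    have e2 : p.2 = x.2 := by rw [hxp']; simp
    obtain ⟨u1, u2, u3⟩ := hA x hx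
    rcases hp2 with (hpG | hpE) | ⟨hqy, hqx⟩ | ⟨hqy, hqx⟩
    · have h1 := hpG.1
      have h2 := hpG.2
      rw [hxp', h_int T.h] at h1 h2
      simp at h1 h2
      rw [u3 h1] at h2
      linarith
    · exact hEA p hpE (not_til hx hxp')
    · have := hX0 p (Or.inl ⟨x, hx, hxp⟩)
      linarith
    · linarith
  · obtain ⟨z1, z2⟩ := hZm p hpZ
    rcases hp2 with (hpG | hpE) | ⟨hqy, hqx⟩ | ⟨hqy, hqx⟩
    · have := hpG.2
      linarith
    · obtain ⟨u1, u2⟩ := hE p hpE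
      have := u2 (by linarith)
      rw [this] at z1
      linarith
    · have := hX0 p (Or.inr hpZ)
      linarith
    · have h2 := abs_le.1 (T.b1 p)
      have h3 : p.2 = h := by linarith
      rw [h3] at h2
      linarith
  · rcases hp2 with (hpG | hpE) | ⟨hqy, hqx⟩ | ⟨hqy, hqx⟩
    · have := hGb p hpG
      linarith
    · have := hEy p hpE
      linarith
    · linarith
    · linarith
  · rcases hp2 with (hpG | hpE) | ⟨hqy, hqx⟩ | ⟨hqy, hqx⟩
    · have := hGb p hpG
      linarith
    · obtain ⟨u1, u2⟩ := hE p hpE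
      have := abs_le.1 (T.b2 p)
      linarith
    · linarith
    · linarith

lemma S4 (T : Tw F C k) {h : ℝ} {q : ℝ × ℝ} {δ : ℝ} (hδ0 : 0 < δ) (hδ1 : δ < 1)
    (hh : q.2 + C < h) (I : ℤ) (hI : ∀ s ≤ q.2, (F (q.1, s)).1 < q.1 + I)
    {A : Set (ℝ × ℝ)} {a w : ℝ × ℝ} (hAJ : JoinedIn A a w)
    (hA : ∀ p ∈ A, p.2 ≤ h ∧ (p.2 = h → p = w)) (hw : w.2 = h)
    (ha : a.2 < q.2 - 1 - C)
    {E2 E3 : Set (ℝ × ℝ)} {e f : ℝ × ℝ} (hE2P : IsPathConnected E2) (hE3P : IsPathConnected E3)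
    (hq2 : q ∈ E2) (he2 : e ∈ E2) (hq3 : q ∈ E3) (hf3 : f ∈ E3)
    (hE2 : ∀ p ∈ E2, p.2 ≤ h ∧ (p.2 = h → p = e)) (he : e.2 = h)
    (hE3 : ∀ p ∈ E3, (F p).2 ≤ h ∧ ((F p).2 = h → p = f)) (hf : (F f).2 = h)
    (hE2y : ∀ p ∈ E2, q.2 - 1 < p.2) (hE3y : ∀ p ∈ E3, q.2 - 1 < p.2)
    (hE2A : ∀ p ∈ E2, p ∉ til A) (hE3A : ∀ p ∈ E3, F p ∉ til A)
    (hJA : ∀ s, q.2 - δ ≤ s → s ≤ q.2 → (q.1, s) ∉ til A ∧ F (q.1, s) ∉ til A)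
    (hE2R : ∀ p, F p ∈ E2 → p ∉ til {p : ℝ × ℝ | p.1 = q.1 ∧ p.2 ≤ q.2 - δ})
    (hE3R : ∀ p ∈ E3, F p ∉ til {p : ℝ × ℝ | p.1 = q.1 ∧ p.2 ≤ q.2 - δ}) :
    (F f).1 ≤ e.1 + I + 1 := by
  have hC := T.one_le
  by_contra hc
  push Not at hc
  set J : Set (ℝ × ℝ) := {p | p.1 = q.1 ∧ q.2 - δ ≤ p.2 ∧ p.2 ≤ q.2} with hJ
  have hqJ : q ∈ J := ⟨rfl, by linarith, le_rfl⟩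
  have hJP : IsPathConnected J := by
    refine ⟨q, hqJ, fun {y} hy => ?_⟩
    have hy1 : y = (q.1, y.2) := by ext <;> simp [hy.1]
    rw [hy1]
    refine joined_seg_v q.1 q.2 y.2 _ ?_
    intro s hs1 hs2
    rw [min_eq_right hy.2.2] at hs1
    rw [max_eq_left hy.2.2] at hs2
    exact ⟨rfl, by simp only; linarith [hy.2.1], hs2⟩
  have hD2P : IsPathConnected (J ∪ E2) := hJP.union hE2P ⟨q, hqJ, hq2⟩
  have hD3P : IsPathConnected (J ∪ E3) := hJP.union hE3P ⟨q, hqJ, hq3⟩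
  -- the merging point
  have merge : ∃ m, m ∈ (fun x => x + ((I:ℝ),(0:ℝ))) '' (J ∪ E2) ∧ m ∈ F '' (J ∪ E3) := by
    have hL := joined_shift (hE2P.joinedIn q hq2 e he2) I
    set N : Set (ℝ × ℝ) := {p | p.1 = q.1 ∧ q.2 - C - 2 ≤ p.2 ∧ p.2 ≤ q.2} with hN
    have hNJ : JoinedIn N (q.1, q.2 - C - 2) q := by
      refine joined_seg_v q.1 (q.2 - C - 2) q.2 _ ?_
      intro s hs1 hs2
      rw [min_eq_left (by linarith)] at hs1
      rw [max_eq_right (by linarith)] at hs2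
      exact ⟨rfl, hs1, hs2⟩
    have hK : JoinedIn (F '' N ∪ F '' E3) (F (q.1, q.2 - C - 2)) (F f) :=
      ((hNJ.map F.continuous).mono Set.subset_union_left).trans
        (((hE3P.joinedIn q hq3 f hf3).map F.continuous).mono Set.subset_union_right)
    have hr2 := abs_le.1 (T.b2 (q.1, q.2 - C - 2))
    have hr1 := hI (q.2 - C - 2) (by linarith)
    simp only at hr2
    obtain ⟨p, hp1, hp2⟩ := crossing hL hK
    simp only [Prod.fst_add, Prod.snd_add, add_zero] at hp1 hp2
    rcases hp1 with hpE | ⟨hpx, hpy⟩ | ⟨hpx, hpy⟩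
    · obtain ⟨x, hx, hxp⟩ := hpE
      have hxp' : p = x + ((I:ℝ),0) := hxp.symm
      have e1 : p.1 = x.1 + I := by rw [hxp']; simp
      have e2 : p.2 = x.2 := by rw [hxp']; simp
      have hxy := hE2y x hx
      rcases hp2 with (⟨n, hn, hnp⟩ | ⟨z, hz, hzp⟩) | ⟨hqy, hqx⟩ | ⟨hqy, hqx⟩
      · by_cases hns : q.2 - δ ≤ n.2
        · exact ⟨p, ⟨x, Or.inr hx, hxp⟩, ⟨n, Or.inl ⟨hn.1, hns, hn.2.2⟩, hnp⟩⟩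
        · exfalso
          push Not at hns
          have h1 : F (n + (((-I : ℤ):ℝ),0)) = x := by
            rw [h_int T.h, hnp, hxp']
            ext <;> simp
          refine hE2R (n + (((-I : ℤ):ℝ),0)) (by rwa [h1]) ⟨I, ?_⟩
          refine ⟨?_, ?_⟩
          · simpa using hn.1
          · simpa using hns.le
      · exact ⟨p, ⟨x, Or.inr hx, hxp⟩, ⟨z, Or.inr hz, hzp⟩⟩
      · exfalso
        linarith
      · exfalso
        have := (hE2 x hx).2 (by linarith)
        rw [this] at e1
        linarith
    · rcases hp2 with (⟨n, hn, hnp⟩ | ⟨z, hz, hzp⟩) | ⟨hqy, hqx⟩ | ⟨hqy, hqx⟩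
      · exfalso
        have h1 := hI n.2 hn.2.2
        have hn' : (q.1, n.2) = n := by ext <;> simp [hn.1]
        rw [hn', hnp] at h1
        linarith
      · by_cases hps : q.2 - δ ≤ p.2
        · refine ⟨p, ⟨(q.1, p.2), Or.inl ⟨rfl, hps, hpy⟩, ?_⟩, ⟨z, Or.inr hz, hzp⟩⟩
          ext <;> simp [hpx]
        · exfalso
          push Not at hps
          refine hE3R z hz ⟨-I, ?_⟩
          rw [hzp]
          refine ⟨?_, ?_⟩
          · simp [hpx]
          · simpa using hps.le
      · exfalso
        linarith
      · exfalso
        linarith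
    · exfalso
      rcases hp2 with (⟨n, hn, hnp⟩ | ⟨z, hz, hzp⟩) | ⟨hqy, hqx⟩ | ⟨hqy, hqx⟩
      · have h1 := abs_le.1 (T.b2 n)
        have h2 := hn.2.2
        rw [hnp] at h1
        linarith
      · obtain ⟨u1, u2⟩ := hE3 z hz
        rw [hzp] at u1 u2
        have := u2 (by linarith)
        rw [← hzp, this] at hpx
        linarith
      · linarith
      · linarith
  obtain ⟨m, hm2, hm3⟩ := merge
  obtain ⟨j, hj1, hj2⟩ := exists_int_between (e.1 + I) (F f).1 w.1 (by linarith)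
  have hB2 : JoinedIn ((fun x => x + ((I:ℝ),(0:ℝ))) '' (J ∪ E2)) (e + ((I:ℝ),0)) m := by
    obtain ⟨x, hx, rfl⟩ := hm2
    exact joined_shift (hD2P.joinedIn e (Or.inr he2) x hx) I
  have hB3 : JoinedIn (F '' (J ∪ E3)) m (F f) := by
    obtain ⟨x, hx, rfl⟩ := hm3
    exact (hD3P.joinedIn x hx f (Or.inr hf3)).map F.continuous
  have hB := (hB2.mono Set.subset_union_left).trans
    (hB3.mono (Set.subset_union_right (s := (fun x => x + ((I:ℝ),(0:ℝ))) '' (J ∪ E2))))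
  have p2 : ∀ p ∈ (fun x => x + ((I:ℝ),(0:ℝ))) '' (J ∪ E2), q.2 - 1 < p.2 ∧ p.2 ≤ h ∧
      (p.2 = h → p = e + ((I:ℝ),0)) ∧ p ∉ til A := by
    rintro _ ⟨x, hx, rfl⟩
    have ht : x ∉ til A → x + ((I:ℝ),(0:ℝ)) ∉ til A := fun hn hm => hn (((til_SInv A).int x I).1 hm)
    simp only [Prod.snd_add, add_zero]
    rcases hx with hx | hx
    · have hx1 : x = (q.1, x.2) := by ext <;> simp [hx.1]
      refine ⟨by linarith [hx.2.1], by linarith [hx.2.2], fun hxh => by linarith [hx.2.2], ht ?_⟩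
      rw [hx1]
      exact (hJA x.2 hx.2.1 hx.2.2).1
    · exact ⟨hE2y x hx, (hE2 x hx).1, fun hxh => by rw [(hE2 x hx).2 hxh], ht (hE2A x hx)⟩
  have p3 : ∀ p ∈ F '' (J ∪ E3), q.2 - 1 - C < p.2 ∧ p.2 ≤ h ∧
      (p.2 = h → p = F f) ∧ p ∉ til A := by
    rintro _ ⟨x, hx, rfl⟩
    have hb := abs_le.1 (T.b2 x)
    rcases hx with hx | hx
    · have hx1 : x = (q.1, x.2) := by ext <;> simp [hx.1]
      refine ⟨by linarith [hx.2.1], by linarith [hx.2.2], fun hxh => by linarith [hx.2.2], ?_⟩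
      rw [hx1]
      exact (hJA x.2 hx.2.1 hx.2.2).2
    · exact ⟨by linarith [hE3y x hx], (hE3 x hx).1, fun hxh => by rw [(hE3 x hx).2 hxh], hE3A x hx⟩
  have pB : ∀ p ∈ (fun x => x + ((I:ℝ),(0:ℝ))) '' (J ∪ E2) ∪ F '' (J ∪ E3), q.2 - 1 - C < p.2 ∧ p.2 ≤ h ∧
      (p.2 = h → p = e + ((I:ℝ),0) ∨ p = F f) ∧ p ∉ til A := by
    rintro p (hp | hp)
    · obtain ⟨h1, h2, h3, h4⟩ := p2 p hp
      exact ⟨by linarith, h2, fun hh => Or.inl (h3 hh), h4⟩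
    · obtain ⟨h1, h2, h3, h4⟩ := p3 p hp
      exact ⟨by linarith, h2, fun hh => Or.inr (h3 hh), h4⟩
  obtain ⟨p, hp1, hp2⟩ := crossing (joined_shift hAJ j) hB
  simp only [Prod.fst_add, Prod.snd_add, add_zero] at hp1 hp2
  rcases hp1 with hpA | ⟨hpx, hpy⟩ | ⟨hpx, hpy⟩
  · obtain ⟨x, hx, hxp⟩ := hpA
    have hxp' : p = x + ((j:ℝ),0) := hxp.symm
    have e1 : p.1 = x.1 + j := by rw [hxp']; simp
    have e2 : p.2 = x.2 := by rw [hxp']; simp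
    obtain ⟨u1, u2⟩ := hA x hx
    rcases hp2 with hpB | ⟨hqy, hqx⟩ | ⟨hqy, hqx⟩
    · exact (pB p hpB).2.2.2 (not_til hx hxp')
    · have := u2 (by linarith)
      rw [this] at e1
      linarith
    · have := u2 (by linarith)
      rw [this] at e1
      linarith
  · rcases hp2 with hpB | ⟨hqy, hqx⟩ | ⟨hqy, hqx⟩
    · linarith [(pB p hpB).1]
    · linarith
    · linarith
  · rcases hp2 with hpB | ⟨hqy, hqx⟩ | ⟨hqy, hqx⟩
    · obtain ⟨h1, h2, h3, h4⟩ := pB p hpB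
      rcases h3 (by linarith) with h5 | h5
      · rw [h5] at hpx
        simp at hpx
        linarith
      · rw [h5] at hpx
        linarith
    · linarith
    · linarith

def Uset (Q : Set (ℝ × ℝ)) (y0 h : ℝ) : Set (ℝ × ℝ) :=
  {p | ∃ a : ℝ × ℝ, a.2 < y0 ∧ JoinedIn {p | p ∉ Q ∧ p.2 < h} a p}

lemma Uset_low {Q : Set (ℝ × ℝ)} {y0 h : ℝ} (hy : ∀ p ∈ Q, y0 ≤ p.2) (hh : y0 < h) (p : ℝ × ℝ)
    (hp : p.2 < y0) : p ∈ Uset Q y0 h :=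
  ⟨p, hp, JoinedIn.refl ⟨fun hq => by linarith [hy p hq], by linarith⟩⟩

lemma Uset_lt {Q : Set (ℝ × ℝ)} {y0 h : ℝ} (p : ℝ × ℝ) (hp : p ∈ Uset Q y0 h) : p.2 < h := by
  obtain ⟨a, _, hj⟩ := hp
  exact hj.target_mem.2

lemma up_bdd (T : Tw F C k) {Q : Set (ℝ × ℝ)} {y0 h : ℝ} (hy : ∀ p ∈ Q, y0 ≤ p.2) (hh : y0 < h)
    (hU : ∀ p ∈ Uset Q y0 h, F p ∈ Uset Q y0 h) (n : ℕ) (p : ℝ × ℝ) :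
    (F^[n] p).2 - p.2 ≤ h - y0 + 2 := by
  obtain ⟨j, hj1, hj2⟩ := exists_int_between (y0 - 2) y0 p.2 (by linarith)
  have h1 : ∀ n : ℕ, F^[n] (p + (0,(j:ℝ))) ∈ Uset Q y0 h := by
    intro n
    induction n with
    | zero => exact Uset_low hy hh _ (by simpa using hj2)
    | succ n ih => rw [Function.iterate_succ_apply']; exact hU _ ih
  have h2 := Uset_lt _ (h1 n)
  rw [v_iter T] at h2
  linarith

lemma down_bdd (T : Tw F C k) {Q : Set (ℝ × ℝ)} {y0 h : ℝ} (hy : ∀ p ∈ Q, y0 ≤ p.2) (hh : y0 < h)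
    (hU : ∀ p, F p ∈ Uset Q y0 h → p ∈ Uset Q y0 h) (n : ℕ) (p : ℝ × ℝ) :
    p.2 - (F^[n] p).2 ≤ h - y0 + 2 := by
  obtain ⟨j, hj1, hj2⟩ := exists_int_between (y0 - 2) y0 (F^[n] p).2 (by linarith)
  have h1 : ∀ (n : ℕ) (p : ℝ × ℝ), F^[n] p ∈ Uset Q y0 h → p ∈ Uset Q y0 h := by
    intro n
    induction n with
    | zero => intro p hp; exact hp
    | succ n ih => intro p hp; exact hU _ (ih _ hp)
  have h2 := Uset_lt _ (h1 n (p + (0,(j:ℝ))) (Uset_low hy hh _ (by rw [v_iter T]; linarith)))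
  simp at h2
  linarith

lemma key (T : Tw F C k) (hk : 0 < k) {Q : Set (ℝ × ℝ)} (hcl : IsClosed Q) (hS : SInv Q)
    (hP : PP Q) (hQ : ∀ p, F p ∈ Q ↔ p ∈ Q) {q : ℝ × ℝ} (hq : q ∈ Q) (hy : ∀ p ∈ Q, q.2 ≤ p.2)
    {h : ℝ} (hh1 : C < h) (hh2 : q.2 + 5 * C + 10 < h) (I : ℤ) (hI1 : k * q.2 + C < I)
    (hI2 : I + C + 5 < k * h)
    (hu : ¬ ∀ p ∈ Uset Q q.2 h, F p ∈ Uset Q q.2 h)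
    (hd : ¬ ∀ p, F p ∈ Uset Q q.2 h → p ∈ Uset Q q.2 h) : False := by
  have hC := T.one_le
  have hb2 : ∀ p, |(F.symm p).2 - p.2| ≤ C := fun p => by
    have := T.b2 (F.symm p)
    rwa [F.apply_symm_apply, abs_sub_comm] at this
  set Y := q.2 - 3 * C - 10 with hYdef
  -- the first arc
  obtain ⟨A1, a1, v1, hA1c, hA1J, ha1, hA1, hv1⟩ := arc_of_not_inv (Y := Y) hy
    (show q.2 < h by linarith) (by linarith) F (fun p => (hQ p).1)
    (fun p hp => by have := abs_le.1 (T.b2 p); linarith)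
    (by push Not at hu; exact hu)
  obtain ⟨A', a', v', hA'c, hA'J, ha', hA', hv'⟩ := arc_of_not_inv (Y := Y) hy
    (show q.2 < h by linarith) (by linarith) F.symm
    (fun p hp => by rw [← hQ, F.apply_symm_apply] at hp; exact hp)
    (fun p hp => by have := abs_le.1 (hb2 p); linarith)
    (by
      push Not at hd
      obtain ⟨p, hp1, hp2⟩ := hd
      refine ⟨F p, hp1, ?_⟩
      rw [F.symm_apply_apply]
      exact hp2)
  set A2 := F.symm '' A' with hA2def
  set a2 := F.symm a' with ha2def
  set w2 := F.symm v' with hw2def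
  have hA2c : IsCompact A2 := hA'c.image F.symm.continuous
  have hA2J : JoinedIn A2 a2 w2 := hA'J.map_continuousOn F.symm.continuous.continuousOn
  have ha2 : a2.2 ≤ Y + C := by have := abs_le.1 (hb2 a'); linarith
  have hA2 : ∀ p ∈ A2, p ∉ Q ∧ (p.2 ≤ h ∧ (p.2 = h → p = w2) ∧ (F p).2 < h) := by
    rintro _ ⟨p, hp, rfl⟩
    obtain ⟨g1, g2, g3, g4⟩ := hA' p hp
    rw [← hQ, F.apply_symm_apply]
    exact ⟨g1, g3, fun e => by rw [g4 e], g2⟩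
  have hw2 : w2.2 = h := hv'
  have tilQ : ∀ A : Set (ℝ × ℝ), (∀ p ∈ A, p ∉ Q) → ∀ p ∈ Q, p ∉ til A := by
    rintro A hA p hp ⟨j, hj⟩
    exact hA _ hj ((hS.int p j).2 hp)
  have hA1Q := tilQ A1 (fun p hp => (hA1 p hp).1)
  have hA2Q := tilQ A2 (fun p hp => (hA2 p hp).1)
  -- delta
  have hopen : IsOpen ((til A2)ᶜ ∩ F ⁻¹' (til A2)ᶜ) :=
    (til_closed hA2c).isOpen_compl.inter ((til_closed hA2c).isOpen_compl.preimage F.continuous)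
  obtain ⟨r, hr, hball⟩ := Metric.isOpen_iff.1 hopen q ⟨hA2Q q hq, hA2Q _ ((hQ q).2 hq)⟩
  obtain ⟨δ, hδ0, hδ1, hδr⟩ : ∃ δ : ℝ, 0 < δ ∧ δ < 1 ∧ δ < r :=
    ⟨min (1/2) (r/2), by positivity, by
      have := min_le_left (1/2 : ℝ) (r/2); linarith, by
      have := min_le_right (1/2 : ℝ) (r/2); linarith⟩
  have hJA : ∀ s, q.2 - δ ≤ s → s ≤ q.2 → (q.1, s) ∉ til A2 ∧ F (q.1, s) ∉ til A2 := by
    intro s hs1 hs2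
    have : (q.1, s) ∈ Metric.ball q r := by
      rw [Metric.mem_ball, Prod.dist_eq]
      simp only [dist_self]
      rw [Real.dist_eq]
      exact max_lt hr (abs_lt.2 ⟨by linarith, by linarith⟩)
    exact hball this
  set R : Set (ℝ × ℝ) := {p : ℝ × ℝ | p.1 = q.1 ∧ p.2 ≤ q.2 - δ} with hR
  have hRQ := tilQ R (fun p hp hpq => by have := hy p hpq; have := hp.2; linarith)
  have hRc : IsClosed (til R) := ray_closed _ _
  -- the obstacle
  set X : Set (ℝ × ℝ) := {p | p.2 ≤ q.2 - 1} ∪ (til A1 ∪ (til A2 ∪ (F ⁻¹' til A2 ∪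
    (F '' til R ∪ F ⁻¹' til R)))) with hX
  have hXc : IsClosed X := by
    refine (isClosed_le continuous_snd continuous_const).union ((til_closed hA1c).union
      ((til_closed hA2c).union (((til_closed hA2c).preimage F.continuous).union
      ((F.isClosedMap _ hRc).union (hRc.preimage F.continuous)))))
  have hXS : SInv X := (SInv.le _).union ((til_SInv _).union ((til_SInv _).union
    (((til_SInv _).preimage F T.h).union (((til_SInv _).image F T.h).union
    ((til_SInv _).preimage F T.h)))))
  have hXQ : ∀ p ∈ Q, p ∉ X := by
    rintro p hp (h1 | h1 | h1 | h1 | ⟨x, hx, rfl⟩ | h1)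
    · have := hy p hp
      have h1' : p.2 ≤ q.2 - 1 := h1
      linarith
    · exact hA1Q p hp h1
    · exact hA2Q p hp h1
    · exact hA2Q _ ((hQ p).2 hp) h1
    · exact hRQ x ((hQ x).1 hp) hx
    · exact hRQ _ ((hQ p).2 hp) h1
  obtain ⟨z, hz, hzJ⟩ := pp_path hP hXc hXS hXQ hq (h + C + 1)
  obtain ⟨γ, hγ⟩ := hzJ
  set c : ℝ → ℝ × ℝ := fun t => γ.extend t with hc
  have hcc : Continuous c := γ.extend.continuous
  have hc0 : c 0 = q := γ.extend_zero
  have hc1 : c 1 = z := γ.extend_one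
  have hcX : ∀ t, c t ∉ X := by
    intro t
    have : c t ∈ Set.range γ := by
      rw [← γ.extend_range]; exact ⟨t, rfl⟩
    obtain ⟨s, hs⟩ := this
    rw [← hs]
    exact hγ s
  have hcy : ∀ t, q.2 - 1 < (c t).2 := fun t => by
    by_contra hcon
    exact hcX t (Or.inl (not_lt.1 hcon))
  obtain ⟨t2, ht20, ht21, he, hE2⟩ := first_hit c hcc Prod.snd continuous_snd h
    (by rw [hc0]; linarith) 1 zero_le_one (by rw [hc1]; linarith)
  obtain ⟨t3, ht30, ht31, hf, hE3⟩ := first_hit c hcc (fun p => (F p).2)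
    (continuous_snd.comp F.continuous) h
    (by rw [hc0]; have := abs_le.1 (T.b2 q); linarith) 1 zero_le_one
    (by rw [hc1]; have := abs_le.1 (T.b2 z); linarith)
  have hS4 := S4 (F := F) (C := C) (k := k) T (h := h) (q := q) (δ := δ) hδ0 hδ1 (by linarith) I
    (fun s hs => by
      have h1 := abs_le.1 (T.b1 (q.1, s))
      have hk' : (0:ℝ) < k := by exact_mod_cast hk
      have h2 : (k:ℝ) * s ≤ k * q.2 := by gcongr
      simp only at h1
      linarith [h1.2])
    hA2J (fun p hp => ⟨(hA2 p hp).2.1, (hA2 p hp).2.2.1⟩) hw2 (by linarith)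
    (E2 := c '' Set.Icc 0 t2) (E3 := c '' Set.Icc 0 t3) (e := c t2) (f := c t3)
    (((convex_Icc 0 t2).isPathConnected ⟨0, le_refl 0, ht20⟩).image hcc)
    (((convex_Icc 0 t3).isPathConnected ⟨0, le_refl 0, ht30⟩).image hcc)
    ⟨0, ⟨le_refl 0, ht20⟩, hc0⟩ ⟨t2, ⟨ht20, le_refl _⟩, rfl⟩
    ⟨0, ⟨le_refl 0, ht30⟩, hc0⟩ ⟨t3, ⟨ht30, le_refl _⟩, rfl⟩
    hE2 he hE3 hf
    (by rintro _ ⟨t, _, rfl⟩; exact hcy t) (by rintro _ ⟨t, _, rfl⟩; exact hcy t)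
    (by rintro _ ⟨t, _, rfl⟩ h1; exact hcX t (Or.inr (Or.inr (Or.inl h1))))
    (by rintro _ ⟨t, _, rfl⟩ h1; exact hcX t (Or.inr (Or.inr (Or.inr (Or.inl h1)))))
    hJA
    (by
      rintro p ⟨t, _, ht⟩ h1
      refine hcX t (Or.inr (Or.inr (Or.inr (Or.inr (Or.inl ?_)))))
      rw [ht]
      exact ⟨p, h1, rfl⟩)
    (by
      rintro _ ⟨t, _, rfl⟩ h1
      exact hcX t (Or.inr (Or.inr (Or.inr (Or.inr (Or.inr h1))))))
  have hS23 : (c t2).1 + k * h - C - 1 ≤ (F (c t3)).1 := by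
    rcases le_total t2 t3 with hle | hle
    · refine S23a T hk (y0 := q.2) hh1 hA1c hA1J (fun p hp => (hA1 p hp).2) hv1 (by linarith)
        (by linarith) (joined_image c hcc t2 t3 hle) ?_ he hf ?_ ?_
      · rintro _ ⟨t, ht, rfl⟩
        exact hE3 _ ⟨t, ⟨by linarith [ht.1], ht.2⟩, rfl⟩
      · rintro _ ⟨t, ht, rfl⟩
        exact hcy t
      · rintro _ ⟨t, _, rfl⟩ h1
        exact hcX t (Or.inr (Or.inl h1))
    · refine S23b T hk (y0 := q.2) hh1 hA2c hA2J (fun p hp => (hA2 p hp).2) hw2 (by linarith)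
        (by linarith) (joined_image c hcc t3 t2 hle) ?_ he hf ?_ ?_
      · rintro _ ⟨t, ht, rfl⟩
        exact hE2 _ ⟨t, ⟨by linarith [ht.1], ht.2⟩, rfl⟩
      · rintro _ ⟨t, ht, rfl⟩
        exact hcy t
      · rintro _ ⟨t, _, rfl⟩ h1
        exact hcX t (Or.inr (Or.inr (Or.inl h1)))
  linarith

lemma step2 (T : Tw F C k) (hk : 0 < k) {Q : Set (ℝ × ℝ)} (hne : Q.Nonempty) (hcl : IsClosed Q)
    (hS : SInv Q) (hP : PP Q) (hFQ : F '' Q = Q) (h0 : ∀ p ∈ Q, 0 ≤ p.2) :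
    (∃ M : ℝ, ∀ (n : ℕ) (p : ℝ × ℝ), (F^[n] p).2 - p.2 ≤ M) ∨
    (∃ M : ℝ, ∀ (n : ℕ) (p : ℝ × ℝ), p.2 - (F^[n] p).2 ≤ M) := by
  obtain ⟨q, hq, hy⟩ := exists_lowest hne hcl hS h0
  have hQ : ∀ p, F p ∈ Q ↔ p ∈ Q := fun p => by
    constructor
    · intro hp
      rw [← hFQ] at hp
      obtain ⟨x, hx, hxp⟩ := hp
      rwa [← F.injective hxp]
    · intro hp
      rw [← hFQ]
      exact ⟨p, hp, rfl⟩
  have hC := T.one_le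
  obtain ⟨I, hI⟩ := exists_int_gt ((k:ℝ) * q.2 + C)
  obtain ⟨h, hh⟩ : ∃ h : ℝ, max (q.2 + 5 * C + 10) (max C (|(I:ℝ)| + C + 5)) < h := exists_gt _
  have e1 := (le_max_left _ _).trans_lt hh
  have e2 := ((le_max_left _ _).trans (le_max_right _ _)).trans_lt hh
  have e3 := ((le_max_right _ _).trans (le_max_right _ _)).trans_lt hh
  have hk1 : (1:ℝ) ≤ k := by exact_mod_cast hk
  by_contra hcon
  push Not at hcon
  refine key T hk hcl hS hP hQ hq hy e2 e1 I hI ?_ ?_ ?_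
  · have := le_abs_self (I:ℝ)
    nlinarith
  · intro hU
    obtain ⟨n, p, hnp⟩ := hcon.1 (h - q.2 + 2)
    have := up_bdd T hy (by linarith) hU n p
    linarith
  · intro hU
    obtain ⟨n, p, hnp⟩ := hcon.2 (h - q.2 + 2)
    have := down_bdd T hy (by linarith) hU n p
    linarith

lemma per_int {G : ℝ × ℝ → ℝ × ℝ} {e : ℝ × ℝ} (h1 : ∀ p, G (p + e) = G p) (j : ℤ) (p : ℝ × ℝ) :
    G (p + (j:ℝ) • e) = G p := by
  have hp : Function.Periodic G e := h1
  rw [Int.cast_smul_eq_zsmul]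
  exact (hp.zsmul j) p

lemma exists_Tw (F : (ℝ × ℝ) ≃ₜ (ℝ × ℝ)) (k : ℤ) (hh : ∀ p, F (p + (1,0)) = F p + (1,0))
    (hv : ∀ p, F (p + (0,1)) = F p + ((k:ℝ),1)) : ∃ C, Tw F C k := by
  set G : ℝ × ℝ → ℝ × ℝ := fun p => F p - (p.1 + k * p.2, p.2) with hG
  have hGc : Continuous G := by
    have := F.continuous
    fun_prop
  have g1 : ∀ p, G (p + (1,0)) = G p := fun p => by
    simp only [hG, hh]
    ext <;> simp
    ring
  have g2 : ∀ p, G (p + (0,1)) = G p := fun p => by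
    simp only [hG, hv]
    ext <;> simp
    ring
  obtain ⟨B, hB⟩ := ((isCompact_Icc (a := (0:ℝ)) (b := 1)).prod
    (isCompact_Icc (a := (0:ℝ)) (b := 1))).exists_bound_of_continuousOn hGc.continuousOn
  have hb : ∀ p, ‖G p‖ ≤ B := by
    intro p
    have e1 : p = ((Int.fract p.1, Int.fract p.2) + ((⌊p.1⌋:ℤ):ℝ) • ((1:ℝ),(0:ℝ)))
        + ((⌊p.2⌋:ℤ):ℝ) • ((0:ℝ),(1:ℝ)) := by
      ext <;> simp
    rw [e1, per_int g2, per_int g1]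
    exact hB _ ⟨⟨Int.fract_nonneg _, (Int.fract_lt_one _).le⟩,
      ⟨Int.fract_nonneg _, (Int.fract_lt_one _).le⟩⟩
  refine ⟨max 1 B, ⟨hh, hv, le_max_left _ _, fun p => ?_, fun p => ?_⟩⟩
  · have := (norm_snd_le (G p)).trans (hb p)
    exact (by simpa [hG] using this : |(F p).2 - p.2| ≤ B).trans (le_max_right _ _)
  · have := (norm_fst_le (G p)).trans (hb p)
    have h3 : |(F p).1 - (p.1 + k * p.2)| ≤ B := by simpa [hG] using this
    rw [← sub_sub] at h3
    exact h3.trans (le_max_right _ _)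

lemma symm_vert (hh : ∀ p, F (p + (1,0)) = F p + (1,0))
    (hv : ∀ p, F (p + (0,1)) = F p + ((k:ℝ),1)) (p : ℝ × ℝ) :
    F.symm (p + (0,1)) = F.symm p + (((-k : ℤ):ℝ),1) := by
  apply F.injective
  rw [F.apply_symm_apply]
  have : F.symm p + (((-k : ℤ):ℝ),1) = (F.symm p + (0,1)) + (((-k : ℤ):ℝ),0) := by
    ext <;> simp
  rw [this, h_int hh, hv, F.apply_symm_apply]
  ext <;> simp

lemma lin_growth (T : Tw F C k) {n : ℕ} {w : ℝ × ℝ} (hw : ∀ j : ℕ, (j:ℝ) ≤ (F^[j * n] w).2) :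
    ∃ ε > (0:ℝ), ∃ N0 : ℕ, ∀ N ≥ N0, ε * N ≤ (F^[N] w).2 - w.2 := by
  have hC := T.one_le
  have hn : 0 < n := by
    rcases Nat.eq_zero_or_pos n with h0 | h0
    · exfalso
      subst h0
      obtain ⟨j, hj⟩ := exists_nat_gt w.2
      have := hw j
      simp at this
      linarith
    · exact h0
  have hn' : (0:ℝ) < n := by exact_mod_cast hn
  obtain ⟨N0, hN0⟩ := exists_nat_gt (2 * n * (1 + n * C + w.2))
  refine ⟨1 / (2 * n), by positivity, N0, fun N hN => ?_⟩
  have h1 : (F^[N] w).2 ≥ ((N / n : ℕ):ℝ) - n * C := by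
    have e : N = N % n + (N / n) * n := by rw [mul_comm]; exact (Nat.mod_add_div N n).symm
    have h2 := iter_lower T (N % n) (F^[(N / n) * n] w)
    rw [← Function.iterate_add_apply, ← e] at h2
    have h3 := hw (N / n)
    have h4 : ((N % n : ℕ):ℝ) ≤ n := by exact_mod_cast (Nat.mod_lt N hn).le
    have h5 : ((N % n : ℕ):ℝ) * C ≤ n * C := by gcongr
    linarith
  have h2 : (N:ℝ) ≤ n * ((N / n : ℕ):ℝ) + n := by
    have := (Nat.mod_lt N hn).le
    have e := Nat.mod_add_div N n
    have : N ≤ n * (N / n) + n := by omega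
    exact_mod_cast this
  have h3 : (N0:ℝ) ≤ N := by exact_mod_cast hN
  have h4 : 1 / (2 * n) * (N:ℝ) = N / (2 * n) := by ring
  rw [h4, div_le_iff₀ (by positivity)]
  nlinarith

lemma iter_symm_apply (F : (ℝ × ℝ) ≃ₜ (ℝ × ℝ)) (n : ℕ) (p : ℝ × ℝ) :
    F^[n] (F.symm^[n] p) = p :=
  (Function.LeftInverse.iterate (f := F.symm) (g := F) (fun x => F.apply_symm_apply x) n) p

lemma symm_iter_apply (F : (ℝ × ℝ) ≃ₜ (ℝ × ℝ)) (n : ℕ) (p : ℝ × ℝ) :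
    F.symm^[n] (F^[n] p) = p :=
  (Function.LeftInverse.iterate (f := F) (g := F.symm) (fun x => F.symm_apply_apply x) n) p

lemma step3 (hk : 0 < k) (hh : ∀ p, F (p + (1,0)) = F p + (1,0))
    (hv : ∀ p, F (p + (0,1)) = F p + ((k:ℝ),1))
    (hup : ∀ M : ℝ, ∃ (n : ℕ) (p : ℝ × ℝ), M < (F^[n] p).2 - p.2)
    (hdn : ∀ M : ℝ, ∃ (n : ℕ) (p : ℝ × ℝ), M < p.2 - (F^[n] p).2) :
    ∃ ε > (0:ℝ), ∃ N0 : ℕ, ∀ N ≥ N0, ∀ r ∈ Set.Icc (-ε) ε, ∃ p, r * N = (F^[N] p).2 - p.2 := by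
  obtain ⟨C, T⟩ := exists_Tw F k hh hv
  obtain ⟨C', T'⟩ := exists_Tw F.symm (-k) (symm_comm F hh) (symm_vert hh hv)
  have noQ : ∀ Q : Set (ℝ × ℝ), Q.Nonempty → IsClosed Q → SInv Q → PP Q → F '' Q = Q →
      (∀ p ∈ Q, 0 ≤ p.2) → False := by
    intro Q h1 h2 h3 h4 h5 h6
    rcases step2 T hk h1 h2 h3 h4 h5 h6 with ⟨M, hM⟩ | ⟨M, hM⟩
    · obtain ⟨n, p, h⟩ := hup M
      linarith [hM n p]
    · obtain ⟨n, p, h⟩ := hdn M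
      linarith [hM n p]
  have hup' : ∀ M : ℝ, ∃ (n : ℕ) (p : ℝ × ℝ), M < (F.symm^[n] p).2 - p.2 := by
    intro M
    obtain ⟨n, p, h⟩ := hdn M
    exact ⟨n, F^[n] p, by rwa [symm_iter_apply]⟩
  obtain ⟨n, w, hw⟩ : ∃ (n : ℕ) (w : ℝ × ℝ), ∀ j : ℕ, (j:ℝ) ≤ (F^[j * n] w).2 := by
    rcases lemmaA T hup with h | ⟨Q, h1, h2, h3, h4, h5, h6⟩
    · exact h
    · exact (noQ Q h1 h2 h3 h4 h5 h6).elim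
  obtain ⟨m, w', hw'⟩ : ∃ (n : ℕ) (w : ℝ × ℝ), ∀ j : ℕ, (j:ℝ) ≤ (F.symm^[j * n] w).2 := by
    rcases lemmaA T' hup' with h | ⟨Q, h1, h2, h3, h4, h5, h6⟩
    · exact h
    · refine (noQ Q h1 h2 h3 h4 ?_ h6).elim
      nth_rewrite 1 [← h5]
      rw [← Set.image_comp]
      simp
  obtain ⟨ε, hε, N1, h1⟩ := lin_growth T hw
  obtain ⟨ε', hε', N2, h2⟩ := lin_growth T' hw'
  refine ⟨min ε ε', lt_min hε hε', max N1 N2, fun N hN r hr => ?_⟩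
  have g1 := h1 N (le_trans (le_max_left _ _) hN)
  have g2 := h2 N (le_trans (le_max_right _ _) hN)
  have hcont : Continuous fun p : ℝ × ℝ => (F^[N] p).2 - p.2 :=
    ((continuous_snd.comp (F.continuous.iterate N))).sub continuous_snd
  have hN0 : (0:ℝ) ≤ N := Nat.cast_nonneg N
  have hr1 : r * N ≤ ε * N := by
    gcongr
    exact hr.2.trans (min_le_left _ _)
  have hr2 : -(ε' * N) ≤ r * N := by
    rw [← neg_mul]
    gcongr
    have := min_le_right ε ε'
    linarith [hr.1]
  obtain ⟨p, hp⟩ := mem_range_of_exists_le_of_exists_ge (c := r * N) hcont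
    ⟨F.symm^[N] w', by simp only [iter_symm_apply]; linarith⟩ ⟨w, by linarith⟩
  exact ⟨p, hp.symm⟩

lemma fhat_iter (L : DehnLift) (fhat : Cyl → Cyl)
    (hfhat : ∀ z : ℝ × ℝ, projCyl (L.F z) = fhat (projCyl z)) (n : ℕ) (z : ℝ × ℝ) :
    fhat^[n] (projCyl z) = projCyl (L.F^[n] z) := by
  induction n with
  | zero => rfl
  | succ n ih => rw [Function.iterate_succ_apply', Function.iterate_succ_apply', ih, hfhat]

lemma projCyl_surj (z : Cyl) : ∃ p : ℝ × ℝ, projCyl p = z := by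
  obtain ⟨x, y⟩ := z
  obtain ⟨x, rfl⟩ := QuotientAddGroup.mk_surjective x
  exact ⟨(x, y), rfl⟩

end Helpers

/-- There is an explicitly computable `M > 0`, depending only on
`f̂`, such that if some orbit moves down by more than `M` and some orbit moves
up by more than `M`, then `0` is an interior point of `ρ_V(f̂)`. -/
theorem large_displacements_imply_zero_interior
    (L : DehnLift) (fhat : Cyl → Cyl)
    (hfhat : ∀ z : ℝ × ℝ, projCyl (L.F z) = fhat (projCyl z)) :
    ∃ M > (0:ℝ), ∀ (z₁ z₂ : Cyl) (n₁ n₂ : ℕ), 0 < n₁ → 0 < n₂ →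
      (fhat^[n₁] z₁).2 - z₁.2 < -M →
      M < (fhat^[n₂] z₂).2 - z₂.2 →
      ∃ ε > (0:ℝ), Set.Icc (-ε) ε ⊆ rotSet fhat := by
  have hit : ∀ (n : ℕ) (p : ℝ × ℝ),
      (fhat^[n] (projCyl p)).2 - (projCyl p).2 = (L.F^[n] p).2 - p.2 := fun n p => by
    rw [fhat_iter L fhat hfhat]
    rfl
  have hh : ∀ p, L.F (p + (1,0)) = L.F p + (1,0) := fun p => by
    have := L.horiz p.1 p.2
    rwa [show ((p.1 + 1, p.2) : ℝ × ℝ) = p + (1,0) by ext <;> simp] at this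
  have hv : ∀ p, L.F (p + (0,1)) = L.F p + ((L.k:ℝ),1) := fun p => by
    have := L.vert p.1 p.2
    rwa [show ((p.1, p.2 + 1) : ℝ × ℝ) = p + (0,1) by ext <;> simp] at this
  by_cases hup : ∀ M : ℝ, ∃ (n : ℕ) (p : ℝ × ℝ), M < (L.F^[n] p).2 - p.2
  · by_cases hdn : ∀ M : ℝ, ∃ (n : ℕ) (p : ℝ × ℝ), M < p.2 - (L.F^[n] p).2
    · obtain ⟨ε, hε, N0, hN⟩ := step3 L.k_pos hh hv hup hdn
      refine ⟨1, one_pos, fun _ _ _ _ _ _ _ _ => ⟨ε, hε, fun r hr => ?_⟩⟩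
      refine Set.mem_iInter.2 fun i => subset_closure ?_
      obtain ⟨p, hp⟩ := hN (max N0 (i + 1)) (le_max_left _ _) r hr
      refine Set.mem_iUnion₂.2 ⟨max N0 (i + 1), le_max_right _ _, projCyl p, ?_⟩
      rw [hit, ← hp]
      have hpos : 0 < max N0 (i + 1) := lt_of_lt_of_le (Nat.succ_pos i) (le_max_right _ _)
      have hne : ((max N0 (i + 1) : ℕ) : ℝ) ≠ 0 := by exact_mod_cast hpos.ne'
      exact (mul_div_cancel_right₀ r hne).symm
    · push Not at hdn
      obtain ⟨M, hM⟩ := hdn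
      refine ⟨max M 1, lt_of_lt_of_le one_pos (le_max_right _ _), ?_⟩
      intro z₁ z₂ n₁ n₂ _ _ h1 _
      exfalso
      obtain ⟨p, rfl⟩ := projCyl_surj z₁
      rw [hit] at h1
      have h3 := hM n₁ p
      have h4 := le_max_left M 1
      linarith
  · push Not at hup
    obtain ⟨M, hM⟩ := hup
    refine ⟨max M 1, lt_of_lt_of_le one_pos (le_max_right _ _), ?_⟩
    intro z₁ z₂ n₁ n₂ _ _ _ h1
    exfalso
    obtain ⟨p, rfl⟩ := projCyl_surj z₂
    rw [hit] at h1
    have h3 := hM n₂ p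
    have h4 := le_max_left M 1
    linarith
end
end

section
/- Let h : ℝ² → ℝ² be a homeomorphism isotopic to the identity (there is a continuous family of homeomorphisms H_t of ℝ², t ∈ [0,1], with H₀ = id and H₁ = h) and without fixed points. Then there is no periodic free chain of disks: there do not exist nonempty open connected sets D₀, D₁, ..., D_{n−1} of ℝ² with pairwise disjoint closures, each free (i.e., h(closure(Dᵢ)) ∩ closure(Dᵢ) = ∅ for all i), such that h(closure(Dᵢ)) ∩ closure(D_{i+1 mod n}) ≠ ∅ for all i = 0, ..., n−1. -/
noncomputable section
open Set Function Topology unitInterval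

/-- Isotopic to the identity (through injective continuous maps). -/
def PIso (f : ℂ → ℂ) : Prop := ∃ H : ℝ → ℂ → ℂ,
  Continuous (fun p : ℝ × ℂ => H p.1 p.2) ∧ (∀ t ∈ Icc (0:ℝ) 1, Injective (H t)) ∧
  H 0 = id ∧ H 1 = f

lemma PIso.comp {f g : ℂ → ℂ} (hf : PIso f) (hg : PIso g) : PIso (f ∘ g) := by
  obtain ⟨H, hH, hi, h0, h1⟩ := hf
  obtain ⟨G, hG, gi, g0, g1⟩ := hg
  refine ⟨fun t => H t ∘ G t, ?_, fun t ht => (hi t ht).comp (gi t ht), by simp [h0, g0],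
    by simp [h1, g1]⟩
  exact hH.comp (continuous_fst.prodMk hG)

lemma PIso.id : PIso (fun z => z) :=
  ⟨fun _ z => z, continuous_snd, fun _ _ _ _ h => h, rfl, rfl⟩

lemma lift_homotopy {A : Type*} [TopologicalSpace A] (Q : I × A → ℂ) (hQ : Continuous Q)
    (hne : ∀ p, Q p ≠ 0) (c : A → ℂ) (hc : Continuous c)
    (h0 : ∀ a, Q (0, a) = Complex.exp (c a)) :
    ∃ L : I × A → ℂ, Continuous L ∧ (∀ p, Complex.exp (L p) = Q p) ∧ ∀ a, L (0, a) = c a := by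
  let H : C(I × A, {z : ℂ // z ≠ 0}) := ⟨fun p => ⟨Q p, hne p⟩, by fun_prop⟩
  have H0 : ∀ a, H (0, a) = (fun z : ℂ => (⟨_, z.exp_ne_zero⟩ : {z : ℂ // z ≠ 0})) ((⟨c, hc⟩ : C(A, ℂ)) a) :=
    fun a => Subtype.ext (h0 a)
  refine ⟨Complex.isCoveringMap_exp.liftHomotopy H ⟨c, hc⟩ H0, ContinuousMap.continuous _, ?_, ?_⟩
  · intro p
    have := congrFun (Complex.isCoveringMap_exp.liftHomotopy_lifts H ⟨c, hc⟩ H0) p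
    exact congrArg Subtype.val this
  · exact Complex.isCoveringMap_exp.liftHomotopy_zero H ⟨c, hc⟩ H0

lemma const_log {X : Type*} [TopologicalSpace X] {S : Set X} (hS : IsPreconnected S)
    (g : X → ℂ) (hg : ContinuousOn g S) (c : ℂ) (hc : ∀ x ∈ S, Complex.exp (g x) = c)
    {x y : X} (hx : x ∈ S) (hy : y ∈ S) : g x = g y := by
  have : PreconnectedSpace S := Subtype.preconnectedSpace hS
  exact Complex.isCoveringMap_exp.const_of_comp (g := S.domRestrict g) hg.domRestrict
    (fun a a' => Subtype.ext (by simp [hc a a.2, hc a' a'.2])) ⟨x, hx⟩ ⟨y, hy⟩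

lemma log_convex {E : Type*} [NormedAddCommGroup E] [NormedSpace ℝ E] {S : Set E}
    (hS : Convex ℝ S) (b : E) (hb : b ∈ S) (F : E → ℂ) (hF : ContinuousOn F S)
    (hne : ∀ p ∈ S, F p ≠ 0) :
    ∃ φ : E → ℂ, ContinuousOn φ S ∧ ∀ p ∈ S, Complex.exp (φ p) = F p := by
  classical
  have hmem : ∀ q : I × S, b + (q.1 : ℝ) • ((q.2 : E) - b) ∈ S := fun q =>
    hS.add_smul_sub_mem hb q.2.2 q.1.2
  obtain ⟨L, hL, hexp, -⟩ := lift_homotopy (A := S)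
    (fun q => F (b + (q.1 : ℝ) • ((q.2 : E) - b)))
    (hF.comp_continuous (by fun_prop) hmem) (fun q => hne _ (hmem q))
    (fun _ => Complex.log (F b)) continuous_const
    (fun a => by simp [Complex.exp_log (hne b hb)])
  refine ⟨fun p => if h : p ∈ S then L (1, ⟨p, h⟩) else 0, ?_, ?_⟩
  · rw [continuousOn_iff_continuous_domRestrict]
    have : S.domRestrict (fun p => if h : p ∈ S then L (1, ⟨p, h⟩) else 0) = fun p : S => L (1, p) := by
      ext p; simp
    rw [this]; fun_prop
  · intro p hp
    simp [hp, hexp]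

lemma pair_log {f : ℂ → ℂ} (hf : PIso f) : ∃ L : ℂ × ℂ → ℂ,
    ContinuousOn L {p | p.1 ≠ p.2} ∧
    (∀ x y, x ≠ y → Complex.exp (L (x, y)) * (x - y) = f x - f y) ∧
    ∀ x y, x ≠ y → L (x, y) = L (y, x) := by
  classical
  obtain ⟨H, hH, hi, h0, h1⟩ := hf
  let S : Set (ℂ × ℂ) := {p | p.1 ≠ p.2}
  have hsub : ∀ p : S, (p : ℂ × ℂ).1 - (p : ℂ × ℂ).2 ≠ 0 := fun p => sub_ne_zero.2 p.2
  have hH' : ∀ {Y : Type} [TopologicalSpace Y] (a : Y → ℝ) (b : Y → ℂ), Continuous a →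
      Continuous b → Continuous (fun y => H (a y) (b y)) := fun a b ha hb =>
    hH.comp (ha.prodMk hb)
  let Q : I × S → ℂ := fun q => (H q.1 (q.2 : ℂ × ℂ).1 - H q.1 (q.2 : ℂ × ℂ).2) /
    ((q.2 : ℂ × ℂ).1 - (q.2 : ℂ × ℂ).2)
  obtain ⟨L, hL, hexp, hL0⟩ := lift_homotopy (A := S) Q
    (by
      refine Continuous.div (Continuous.sub (hH' _ _ (by fun_prop) (by fun_prop))
        (hH' _ _ (by fun_prop) (by fun_prop))) (by fun_prop) (fun q => hsub q.2))
    (fun q => div_ne_zero (sub_ne_zero.2 fun h => q.2.2 (hi q.1 q.1.2 h)) (hsub q.2))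
    (fun _ => 0) continuous_const
    (fun a => by simp [Q, h0, div_self (hsub a)])
  refine ⟨fun p => if h : p ∈ S then L (1, ⟨p, h⟩) else 0, ?_, ?_, ?_⟩
  · change ContinuousOn _ S
    rw [continuousOn_iff_continuous_domRestrict]
    have : S.domRestrict (fun p => if h : p ∈ S then L (1, ⟨p, h⟩) else 0) = fun p : S => L (1, p) := by
      ext p; simp
    rw [this]; fun_prop
  · intro x y hxy
    have hm : (x, y) ∈ S := hxy
    simp only [hm, dite_true, hexp, Q]
    simp [h1, div_mul_cancel₀ _ (sub_ne_zero.2 hxy)]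
  · intro x y hxy
    have hm : (x, y) ∈ S := hxy
    have hm' : (y, x) ∈ S := hxy.symm
    simp only [hm, hm', dite_true]
    have key : (fun t : I => L (t, ⟨(x, y), hm⟩)) = fun t : I => L (t, ⟨(y, x), hm'⟩) := by
      refine Complex.isCoveringMap_exp.eq_of_comp_eq (by fun_prop) (by fun_prop) ?_ 0 ?_
      · ext t
        simp only [comp_apply, hexp, Q]
        rw [← neg_sub (H t y), ← neg_sub y x, neg_div_neg_eq]
      · simp [hL0]
    exact congrFun key 1

/-- Logarithm of the displacement and its relation to the pair logarithm. -/
lemma displacement {f : ℂ → ℂ} (hf : PIso f) (hc : Continuous f) (hfix : ∀ z, f z ≠ z) :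
    ∃ (L : ℂ × ℂ → ℂ) (θ : ℂ → ℂ) (κ : ℂ), ContinuousOn L {p | p.1 ≠ p.2} ∧
    (∀ x y, x ≠ y → Complex.exp (L (x, y)) * (x - y) = f x - f y) ∧
    (∀ x y, x ≠ y → L (x, y) = L (y, x)) ∧ Continuous θ ∧
    (∀ z, Complex.exp (θ z) = f z - z) ∧ Complex.exp κ = 1 ∧
    ∀ z, L (z, f z) = θ (f z) - θ z + κ := by
  obtain ⟨L, hL, hexp, hsymm⟩ := pair_log hf
  obtain ⟨θ, hθ, hθe⟩ := log_convex (convex_univ (𝕜 := ℝ) (E := ℂ)) 0 (mem_univ _)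
    (fun z => f z - z) (by fun_prop) (fun p _ => sub_ne_zero.2 (hfix p))
  rw [continuousOn_univ] at hθ
  have hθe' : ∀ z, Complex.exp (θ z) = f z - z := fun z => hθe z (mem_univ _)
  have he : ∀ z, Complex.exp (L (z, f z) - (θ (f z) - θ z)) = 1 := by
    intro z
    have h1 := hexp z (f z) (hfix z).symm
    have hz := sub_ne_zero.2 (hfix z)
    have hz' := sub_ne_zero.2 (hfix (f z))
    rw [Complex.exp_sub, Complex.exp_sub, hθe', hθe']
    have : Complex.exp (L (z, f z)) = (f (f z) - f z) / (f z - z) := by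
      rw [eq_div_iff hz]; linear_combination -h1
    rw [this]; field_simp
  refine ⟨L, θ, L (0, f 0) - (θ (f 0) - θ 0), hL, hexp, hsymm, hθ, hθe', he 0, ?_⟩
  intro z
  have := const_log (isPreconnected_univ (α := ℂ)) (fun z => L (z, f z) - (θ (f z) - θ z))
    (by
      rw [continuousOn_univ]
      refine Continuous.sub (hL.comp_continuous (by fun_prop) fun z => (hfix z).symm) (by fun_prop))
    1 (fun z _ => he z) (mem_univ z) (mem_univ 0)
  linear_combination this

lemma no_period_two {f : ℂ → ℂ} (hf : PIso f) (hc : Continuous f) (hfix : ∀ z, f z ≠ z)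
    (x : ℂ) (hx : f (f x) = x) : False := by
  obtain ⟨L, θ, κ, -, -, hsymm, -, hθe, -, hκ⟩ := displacement hf hc hfix
  have h1 := hκ x
  have h2 := hκ (f x)
  rw [hx, hsymm _ _ (hfix x)] at h2
  have h3 : θ x = θ (f x) := by linear_combination (h1 - h2) / 2
  have h4 := hθe x
  rw [h3, hθe, hx] at h4
  apply hfix x
  linear_combination -h4 / 2

lemma no_simple_loop {f : ℂ → ℂ} (hf : PIso f) (hc : Continuous f) (hfix : ∀ z, f z ≠ z)
    (n : ℝ) (hn : 2 ≤ n) (α : ℝ → ℂ) (hα : Continuous α)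
    (hstep : ∀ t ∈ Icc 0 (n - 1), α (t + 1) = f (α t)) (hper : α n = α 0)
    (hinj : ∀ s t, 0 ≤ s → s < t → t ≤ n → (0 < s ∨ t < n) → α s ≠ α t) : False := by
  obtain ⟨L, θ, κ, hL, hexp, hsymm, hθ, hθe, hκ1, hκ⟩ := displacement hf hc hfix
  let R : Set (ℝ × ℝ) := {p | 0 ≤ p.1 ∧ p.1 < p.2 ∧ p.2 ≤ n ∧ p.2 - p.1 < n}
  have hRc : Convex ℝ R := by
    rintro ⟨a, b⟩ ⟨h1, h2, h3, h4⟩ ⟨a', b'⟩ ⟨h1', h2', h3', h4'⟩ u v hu hv huv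
    simp only [R, mem_ofPred_eq, Prod.smul_mk, Prod.mk_add_mk, smul_eq_mul] at *
    obtain rfl : u = 1 - v := by linarith
    refine ⟨by positivity, ?_, ?_, ?_⟩
    · rcases hv.eq_or_lt with rfl | hv
      · simpa using h2
      · nlinarith
    · nlinarith
    · rcases hv.eq_or_lt with rfl | hv
      · simpa using h4
      · nlinarith
  obtain ⟨φ, hφ, hφe⟩ := log_convex hRc (0, 1) ⟨by simp, by simp, by simp; linarith, by simp; linarith⟩
    (fun p => α p.2 - α p.1) (by fun_prop) (by
      rintro ⟨s, t⟩ ⟨h1, h2, h3, h4⟩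
      simp only at *
      refine sub_ne_zero.2 (hinj s t h1 h2 h3 ?_).symm
      by_contra hcon
      push Not at hcon
      linarith)
  have hφe' : ∀ s t, (s, t) ∈ R → Complex.exp (φ (s, t)) = α t - α s := fun s t h => hφe _ h
  have hne : ∀ s t, (s, t) ∈ R → α t - α s ≠ 0 := fun s t h => by
    rw [← hφe' s t h]; exact Complex.exp_ne_zero _
  -- diagonal
  have E3 : ∀ s ∈ Icc (0:ℝ) (n-1), ∀ t ∈ Icc (0:ℝ) (n-1),
      θ (α s) - φ (s, s + 1) = θ (α t) - φ (t, t + 1) := by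
    have hm : ∀ s ∈ Icc (0:ℝ) (n-1), (s, s + 1) ∈ R := fun s hs =>
      ⟨hs.1, by simp, by linarith [hs.2], by simp; linarith⟩
    intro s hs t ht
    refine const_log (isPreconnected_Icc (a := (0:ℝ)) (b := n - 1))
      (fun s => θ (α s) - φ (s, s + 1)) ?_ 1 ?_ hs ht
    · exact ContinuousOn.sub (by fun_prop) (hφ.comp (by fun_prop) hm)
    · intro s hs
      rw [Complex.exp_sub, hθe, hφe' _ _ (hm s hs), hstep s hs, div_self]
      exact sub_ne_zero.2 (hfix _)
  -- shift
  let R' : Set (ℝ × ℝ) := {p | 0 ≤ p.1 ∧ p.1 < p.2 ∧ p.2 ≤ n - 1}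
  have hR'c : Convex ℝ R' := by
    rintro ⟨a, b⟩ ⟨h1, h2, h3⟩ ⟨a', b'⟩ ⟨h1', h2', h3'⟩ u v hu hv huv
    simp only [R', mem_ofPred_eq, Prod.smul_mk, Prod.mk_add_mk, smul_eq_mul] at *
    obtain rfl : u = 1 - v := by linarith
    refine ⟨by positivity, ?_, ?_⟩
    · rcases hv.eq_or_lt with rfl | hv
      · simpa using h2
      · nlinarith
    · nlinarith
  have hR'R : ∀ p ∈ R', p ∈ R := fun p ⟨h1, h2, h3⟩ => ⟨h1, h2, by linarith, by linarith⟩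
  have hR'R1 : ∀ p ∈ R', (p.1 + 1, p.2 + 1) ∈ R := fun p ⟨h1, h2, h3⟩ =>
    ⟨by simp only; linarith, by simp only; linarith, by simp only; linarith, by simp only; linarith⟩
  have E2 : ∀ p ∈ R', ∀ q ∈ R',
      L (α p.1, α p.2) + φ p - φ (p.1 + 1, p.2 + 1) = L (α q.1, α q.2) + φ q - φ (q.1 + 1, q.2 + 1) := by
    intro p hp q hq
    refine const_log hR'c.isPreconnected
      (fun p => L (α p.1, α p.2) + φ p - φ (p.1 + 1, p.2 + 1)) ?_ 1 ?_ hp hq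
    · refine ContinuousOn.sub (ContinuousOn.add (hL.comp (by fun_prop) ?_) (hφ.mono hR'R))
        (hφ.comp (by fun_prop) hR'R1)
      intro p hp
      exact (sub_ne_zero.1 (hne p.1 p.2 (hR'R p hp))).symm
    · rintro ⟨s, t⟩ hp
      have h1 := hne s t (hR'R _ hp)
      have h2 := hne _ _ (hR'R1 _ hp)
      have h3 := hexp (α s) (α t) (sub_ne_zero.1 h1).symm
      obtain ⟨h4, h5, h6⟩ := hp
      simp only at *
      rw [Complex.exp_sub, Complex.exp_add, hφe' _ _ (hR'R (s, t) ⟨h4, h5, h6⟩),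
        hφe' _ _ (hR'R1 (s, t) ⟨h4, h5, h6⟩), div_eq_one_iff_eq h2,
        hstep s ⟨h4, by linarith⟩, hstep t ⟨by linarith, h6⟩]
      linear_combination -h3
  -- antipodal
  have E4 : ∀ s ∈ Ioo (0:ℝ) n, ∀ t ∈ Ioo (0:ℝ) n, φ (s, n) - φ (0, s) = φ (t, n) - φ (0, t) ∧
      Complex.exp (φ (s, n) - φ (0, s)) = -1 := by
    have hm1 : ∀ s ∈ Ioo (0:ℝ) n, (s, n) ∈ R := fun s hs =>
      ⟨hs.1.le, hs.2, le_rfl, by simp only; linarith [hs.1]⟩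
    have hm2 : ∀ s ∈ Ioo (0:ℝ) n, (0, s) ∈ R := fun s hs =>
      ⟨le_rfl, hs.1, hs.2.le, by simp only; linarith [hs.2]⟩
    have he : ∀ s ∈ Ioo (0:ℝ) n, Complex.exp (φ (s, n) - φ (0, s)) = -1 := by
      intro s hs
      rw [Complex.exp_sub, hφe' _ _ (hm1 s hs), hφe' _ _ (hm2 s hs),
        div_eq_iff (hne _ _ (hm2 s hs)), hper]
      ring
    intro s hs t ht
    refine ⟨const_log (isPreconnected_Ioo (a := (0:ℝ)) (b := n))
      (fun s => φ (s, n) - φ (0, s)) ?_ (-1) he hs ht, he s hs⟩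
    exact ContinuousOn.sub (hφ.comp (by fun_prop) hm1) (hφ.comp (by fun_prop) hm2)
  have m0 : (0:ℝ) ∈ Icc (0:ℝ) (n-1) := ⟨le_rfl, by linarith⟩
  have m1 : (1:ℝ) ∈ Icc (0:ℝ) (n-1) := ⟨by norm_num, by linarith⟩
  have mn : (n-1:ℝ) ∈ Icc (0:ℝ) (n-1) := ⟨by linarith, le_rfl⟩
  have a1 : α 1 = f (α 0) := by simpa using hstep 0 m0
  have an : α 0 = f (α (n-1)) := by rw [← hstep _ mn, ← hper]; simp
  have e1 := hκ (α 0)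
  have e2 := hκ (α (n-1))
  rw [← a1] at e1
  rw [← an] at e2
  have d1 := E3 1 m1 0 m0
  have d2 := E3 (n-1) mn 0 m0
  have s1 := E2 (0, n-1) ⟨le_rfl, by simp only; linarith, le_rfl⟩ (0, 1) ⟨le_rfl, by simp, by simp only; linarith⟩
  have c1 := E4 1 ⟨by norm_num, by linarith⟩ (n-1) ⟨by linarith, by linarith⟩
  have sy := hsymm (α 0) (α (n-1)) (hinj 0 (n-1) le_rfl (by linarith) (by linarith) (Or.inr (by linarith)))
  simp only [zero_add, sub_add_cancel] at *
  obtain ⟨c1, c2⟩ := c1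
  have : φ (1, n) - φ (0, 1) = 0 := by
    linear_combination (1/2 : ℂ) * (c1 - s1 - e1 + e2 + sy - d1 - d2)
  rw [this] at c2
  norm_num at c2

/-- Local push. -/
lemma local_push (z₀ w : ℂ) (r : ℝ) (hw : dist w z₀ < r) : ∃ g : ℂ ≃ₜ ℂ, PIso g ∧
    (∀ z, r ≤ dist z z₀ → g z = z) ∧ g z₀ = w := by
  have hr : 0 < r := lt_of_le_of_lt dist_nonneg hw
  let c : ℝ := dist w z₀ / r
  have hc0 : 0 ≤ c := by positivity
  have hc1 : c < 1 := by rw [div_lt_one hr]; exact hw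
  let u : ℂ → ℂ := fun z => (max (1 - dist z z₀ / r) 0 : ℝ) • (w - z₀)
  have hu : Continuous u := by fun_prop
  have hlip : ∀ x y, ‖u x - u y‖ ≤ c * ‖x - y‖ := by
    intro x y
    have h1 : |max (1 - dist x z₀ / r) 0 - max (1 - dist y z₀ / r) 0| ≤ ‖x - y‖ / r := by
      refine (abs_max_sub_max_le_abs _ _ _).trans ?_
      have : 1 - dist x z₀ / r - (1 - dist y z₀ / r) = (dist y z₀ - dist x z₀) / r := by ring
      rw [this, abs_div, abs_of_pos hr]
      gcongr
      rw [← dist_eq_norm, dist_comm x y]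
      exact abs_dist_sub_le y x z₀
    simp only [u, ← sub_smul, norm_smul, Real.norm_eq_abs]
    calc _ ≤ ‖x - y‖ / r * ‖w - z₀‖ := by gcongr
      _ = c * ‖x - y‖ := by simp only [c, dist_eq_norm]; ring
  have happ : ApproximatesLinearOn (fun z => z + u z)
      ((ContinuousLinearEquiv.refl ℝ ℂ : ℂ ≃L[ℝ] ℂ) : ℂ →L[ℝ] ℂ) univ ⟨c, hc0⟩ := by
    intro x _ y _
    have : x + u x - (y + u y) - ((ContinuousLinearEquiv.refl ℝ ℂ : ℂ ≃L[ℝ] ℂ) : ℂ →L[ℝ] ℂ) (x - y)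
        = u x - u y := by simp; ring
    rw [this]
    exact hlip x y
  have hinv : (⟨c, hc0⟩ : NNReal) <
      ‖((ContinuousLinearEquiv.refl ℝ ℂ).symm : ℂ →L[ℝ] ℂ)‖₊⁻¹ := by
    have : ‖((ContinuousLinearEquiv.refl ℝ ℂ).symm : ℂ →L[ℝ] ℂ)‖₊ = 1 := by
      apply NNReal.eq
      exact ContinuousLinearMap.norm_id
    rw [this, inv_one]
    exact hc1
  refine ⟨happ.toHomeomorph _ (Or.inr hinv), ⟨fun t z => z + t • u z, by fun_prop, ?_, ?_, ?_⟩, ?_, ?_⟩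
  · intro t ht x y hxy
    simp only at hxy
    have h1 : x - y = t • (u y - u x) := by rw [smul_sub]; linear_combination hxy
    have h2 : ‖x - y‖ ≤ c * ‖x - y‖ := by
      calc ‖x - y‖ = |t| * ‖u y - u x‖ := by
            conv_lhs => rw [h1, norm_smul, Real.norm_eq_abs]
        _ ≤ 1 * ‖u y - u x‖ := by gcongr; rw [abs_of_nonneg ht.1]; exact ht.2
        _ ≤ c * ‖x - y‖ := by rw [one_mul, norm_sub_rev]; exact hlip x y
    have h3 : ‖x - y‖ = 0 := by nlinarith [norm_nonneg (x - y)]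
    exact sub_eq_zero.1 (norm_eq_zero.1 h3)
  · ext z; simp
  · ext z
    change z + (1:ℝ) • u z = z + u z
    simp
  · intro z hz
    change z + u z = z
    have : max (1 - dist z z₀ / r) 0 = 0 := max_eq_right (by
      rw [sub_nonpos, one_le_div hr]; exact hz)
    simp [u, this]
  · change z₀ + u z₀ = w
    simp [u]

lemma push {V K : Set ℂ} (hV : IsOpen V) (hK : IsPreconnected K) (hKV : K ⊆ V) {a b : ℂ}
    (ha : a ∈ K) (hb : b ∈ K) : ∃ g : ℂ ≃ₜ ℂ, PIso g ∧ (∀ z, z ∉ V → g z = z) ∧ g a = b := by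
  refine hK.induction₂' (fun a b => ∃ g : ℂ ≃ₜ ℂ, PIso g ∧ (∀ z, z ∉ V → g z = z) ∧ g a = b)
    ?_ ?_ ha hb
  · intro x hx
    obtain ⟨r, hr, hrV⟩ := Metric.isOpen_iff.1 hV x (hKV hx)
    filter_upwards [nhdsWithin_le_nhds (Metric.ball_mem_nhds x (half_pos hr))] with y hy
    rw [Metric.mem_ball] at hy
    constructor
    · obtain ⟨g, h1, h2, h3⟩ := local_push x y r (by linarith)
      refine ⟨g, h1, fun z hz => h2 z ?_, h3⟩
      by_contra hcon
      exact hz (hrV (by simpa using hcon))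
    · obtain ⟨g, h1, h2, h3⟩ := local_push y x (r/2) (by rwa [dist_comm])
      refine ⟨g, h1, fun z hz => h2 z ?_, h3⟩
      by_contra hcon
      refine hz (hrV ?_)
      rw [Metric.mem_ball]
      linarith [dist_triangle z y x]
  · rintro x y z - - - ⟨g, h1, h2, h3⟩ ⟨g', h1', h2', h3'⟩
    refine ⟨g.trans g', ?_, fun z hz => ?_, by simp [h3, h3']⟩
    · exact h1'.comp h1
    · simp [h2 z hz, h2' z hz]

lemma push_mem {V : Set ℂ} {g : ℂ ≃ₜ ℂ} (h : ∀ z, z ∉ V → g z = z) {z : ℂ} (hz : z ∈ V) :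
    g z ∈ V := by
  by_contra hcon
  have := g.injective (h _ hcon)
  rw [this] at hcon
  exact hcon hz

/-- No periodic point of period `m`. -/
def NoPer (m : ℕ) : Prop := ∀ f : ℂ ≃ₜ ℂ, PIso f → (∀ z, f z ≠ z) → ∀ x, f^[m] x ≠ x

lemma reduction (n : ℕ) (hP : ∀ m, 1 ≤ m → m < n → NoPer m) (f : ℂ ≃ₜ ℂ) (hf : PIso f)
    (hfix : ∀ z, f z ≠ z) (a : ℝ → ℂ) (hac : Continuous a)
    (hfree : ∀ s ∈ Ico (0:ℝ) 1, ∀ t ∈ Ico (0:ℝ) 1, f (a t) ≠ a s) (m : ℕ) :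
    1 ≤ m → m < n → ∀ s ∈ Ico (0:ℝ) 1, ∀ t ∈ Ico (0:ℝ) 1, f^[m] (a t) ≠ a s := by
  induction m using Nat.strong_induction_on with
  | _ m ih =>
  intro hm1 hmn s hs t ht heq
  rcases Nat.lt_or_ge m 2 with h2 | h2
  · obtain rfl : m = 1 := by omega
    exact hfree s hs t ht heq
  let K : Set ℂ := a '' uIcc s t
  have hsub : uIcc s t ⊆ Ico (0:ℝ) 1 := ordConnected_Ico.uIcc_subset hs ht
  have hKc : IsCompact K := isCompact_uIcc.image hac
  have hKp : IsPreconnected K := isPreconnected_uIcc.image _ hac.continuousOn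
  let P : Set ℂ := f '' K ∪ (fun j => f^[j] (a t)) '' {j | 1 ≤ j ∧ j < m}
  have hPc : IsClosed P := by
    refine (hKc.image f.continuous).isClosed.union (Set.Finite.isClosed (Set.Finite.image _ ?_))
    exact (Set.finite_lt_nat m).subset fun j hj => hj.2
  have hdis : Disjoint K P := by
    rw [Set.disjoint_left]
    rintro _ ⟨p, hp, rfl⟩ (⟨_, ⟨q, hq, rfl⟩, h⟩ | ⟨j, ⟨hj1, hj2⟩, h⟩)
    · exact hfree p (hsub hp) q (hsub hq) h
    · exact ih j hj2 hj1 (by omega) p (hsub hp) t ht h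
  obtain ⟨A, B, hA, hB, hKA, hPB, hAB⟩ := SeparatedNhds.of_isCompact_isClosed hKc hPc hdis
  rw [Set.disjoint_left] at hAB
  let V := A ∩ f ⁻¹' B
  have hV : IsOpen V := hA.inter (hB.preimage f.continuous)
  have hKV : K ⊆ V := fun k hk => ⟨hKA hk, hPB (Or.inl ⟨k, hk, rfl⟩)⟩
  obtain ⟨g, hg1, hg2, hg3⟩ := push hV hKp hKV (a := a s) (b := a t)
    ⟨s, left_mem_uIcc, rfl⟩ ⟨t, right_mem_uIcc, rfl⟩
  have hj : ∀ j, j < m → (f.trans g)^[j] (a t) = f^[j] (a t) := by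
    intro j
    induction j with
    | zero => intro _; rfl
    | succ j ihj =>
      intro hjm
      rw [iterate_succ_apply', ihj (by omega), iterate_succ_apply']
      simp only [Homeomorph.trans_apply]
      apply hg2
      rintro ⟨hA', -⟩
      exact hAB hA' (hPB (Or.inr ⟨j + 1, ⟨by omega, hjm⟩, iterate_succ_apply' _ _ _⟩))
  refine hP m hm1 hmn (f.trans g) (hg1.comp hf) ?_ (a t) ?_
  · intro z hz
    simp only [Homeomorph.trans_apply] at hz
    by_cases hfz : f z ∈ V
    · have := push_mem hg2 hfz
      rw [hz] at this
      exact hAB hfz.1 this.2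
    · rw [hg2 _ hfz] at hz
      exact hfix z hz
  · obtain ⟨k, rfl⟩ : ∃ k, m = k + 1 := ⟨m - 1, by omega⟩
    rw [iterate_succ_apply', hj k (by omega), Homeomorph.trans_apply, ← iterate_succ_apply' f, heq, hg3]

lemma extend (f : ℂ → ℂ) (hf : Continuous f) (a : ℝ → ℂ) (ha : Continuous a) (h1 : a 1 = f (a 0))
    (N : ℕ) : ∃ γ : ℝ → ℂ, Continuous γ ∧ (∀ t ≤ 1, γ t = a t) ∧
      ∀ t ∈ Icc (0:ℝ) N, γ (t + 1) = f (γ t) := by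
  induction N with
  | zero =>
    refine ⟨a, ha, fun _ _ => rfl, ?_⟩
    rintro t ⟨h0, h0'⟩
    obtain rfl : t = 0 := le_antisymm (by simpa using h0') h0
    simpa using h1
  | succ N ih =>
    obtain ⟨γ, hγ, hγa, hγs⟩ := ih
    refine ⟨fun t => if t ≤ 1 then a t else f (γ (t - 1)), ?_, ?_, ?_⟩
    · refine Continuous.if_le ha (by fun_prop) continuous_id continuous_const ?_
      rintro t rfl
      simp [h1, hγa 0 (by norm_num)]
    · intro t ht; simp [ht]
    · rintro t ⟨ht0, htN⟩
      push_cast at htN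
      have e1 : (if t + 1 ≤ 1 then a (t + 1) else f (γ (t + 1 - 1))) = f (γ t) := by
        split_ifs with h
        · obtain rfl : t = 0 := by linarith
          simp [h1, hγa 0 (by norm_num)]
        · simp
      simp only [e1]
      split_ifs with h
      · rw [hγa t h]
      · rw [← hγs (t - 1) ⟨by linarith, by linarith⟩]; simp

/-- Critical ball. -/
lemma critical (f : ℂ ≃ₜ ℂ) (hfix : ∀ z, f z ≠ z) (x : ℂ) : ∃ (r : ℝ) (y : ℂ), 0 < r ∧
    dist y x = r ∧ dist (f y) x = r ∧
    (∀ p, dist p x < r → ¬ dist (f p) x ≤ r) ∧ (∀ p, dist p x ≤ r → ¬ dist (f p) x < r) := by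
  let M : ℂ → ℝ := fun z => max (dist z x) (dist (f z) x)
  have hM : Continuous M := by have := f.continuous; fun_prop
  obtain ⟨y, hy⟩ := hM.exists_forall_le (Filter.tendsto_atTop_mono (fun z => le_max_left _ _)
    (tendsto_dist_right_cocompact_atTop x))
  have hr : 0 < M y := by
    by_contra hcon
    have h1 : dist y x ≤ 0 := (le_max_left _ _).trans (not_lt.1 hcon)
    have h2 : dist (f y) x ≤ 0 := (le_max_right _ _).trans (not_lt.1 hcon)
    exact hfix y ((dist_le_zero.1 h2).trans (dist_le_zero.1 h1).symm)
  have key : ∀ p, dist p x < M y → dist (f p) x < M y → False := fun p h1 h2 =>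
    absurd (hy p) (not_le.2 (max_lt h1 h2))
  have c1 : ∀ p, dist p x < M y → ¬ dist (f p) x ≤ M y := by
    intro p hp hfp
    have ho : IsOpen (f '' Metric.ball x (M y)) := f.isOpenMap _ Metric.isOpen_ball
    have hcl : f p ∈ closure (Metric.ball x (M y)) := by
      rw [closure_ball x hr.ne']; exact hfp
    obtain ⟨_, ⟨q, hq, rfl⟩, hq'⟩ := mem_closure_iff.1 hcl _ ho ⟨p, hp, rfl⟩
    exact key q hq hq'
  have c2 : ∀ p, dist p x ≤ M y → ¬ dist (f p) x < M y := by
    intro p hp hfp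
    have ho : IsOpen (f ⁻¹' Metric.ball x (M y)) := Metric.isOpen_ball.preimage f.continuous
    have hcl : p ∈ closure (Metric.ball x (M y)) := by
      rw [closure_ball x hr.ne']; exact hp
    obtain ⟨q, hq, hq'⟩ := mem_closure_iff.1 hcl _ ho hfp
    exact key q hq' hq
  refine ⟨M y, y, hr, ?_, ?_, c1, c2⟩
  · exact le_antisymm (le_max_left _ _) (not_lt.1 fun h => c1 y h (le_max_right _ _))
  · exact le_antisymm (le_max_right _ _) (not_lt.1 fun h => c2 y (le_max_left _ _) h)

lemma exists_arc (f : ℂ ≃ₜ ℂ) (hfix : ∀ z, f z ≠ z) (x : ℂ) : ∃ a : ℝ → ℂ, Continuous a ∧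
    a 1 = f (a 0) ∧ a (1/2) = x ∧
    (∀ s ∈ Ico (0:ℝ) 1, ∀ t ∈ Ico (0:ℝ) 1, a s = a t → s = t) ∧
    (∀ s ∈ Ico (0:ℝ) 1, ∀ t ∈ Ico (0:ℝ) 1, f (a t) ≠ a s) := by
  obtain ⟨r, y, hr, hy, hfy, c1, c2⟩ := critical f hfix x
  let a : ℝ → ℂ := fun t => x + (max (1 - 2 * t) 0) • (y - x) + (max (2 * t - 1) 0) • (f y - x)
  have al : ∀ t ≤ 1/2, a t = x + (1 - 2 * t) • (y - x) := by
    intro t ht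
    simp only [a]
    rw [max_eq_left (by linarith), max_eq_right (by linarith)]; simp
  have ar : ∀ t, 1/2 ≤ t → a t = x + (2 * t - 1) • (f y - x) := by
    intro t ht
    simp only [a]
    rw [max_eq_right (by linarith), max_eq_left (by linarith)]; simp
  have hd : ∀ t, dist (a t) x = |1 - 2 * t| * r := by
    intro t
    rcases le_total t (1/2) with h | h
    · rw [al t h, dist_eq_norm, add_sub_cancel_left, norm_smul, ← dist_eq_norm y x, hy, Real.norm_eq_abs]
    · rw [ar t h, dist_eq_norm, add_sub_cancel_left, norm_smul, ← dist_eq_norm (f y) x, hfy, Real.norm_eq_abs,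
        abs_sub_comm]
  have a0 : a 0 = y := by rw [al 0 (by norm_num)]; simp
  have a1 : a 1 = f y := by rw [ar 1 (by norm_num)]; norm_num
  have hlt : ∀ t ∈ Ico (0:ℝ) 1, t ≠ 0 → dist (a t) x < r := by
    rintro t ⟨h0, h1⟩ hne
    have h0' := lt_of_le_of_ne h0 hne.symm
    rw [hd]
    have : |1 - 2 * t| < 1 := by rw [abs_lt]; constructor <;> linarith
    nlinarith
  have hneq : ∀ s t : ℝ, s < t → a s ≠ a t := by
    intro s t hst heq
    have h1 := hd s
    rw [heq, hd t] at h1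
    have h2 : |1 - 2 * t| = |1 - 2 * s| := mul_right_cancel₀ hr.ne' h1
    rcases abs_eq_abs.1 h2 with h | h
    · linarith
    · rw [al s (by linarith), ar t (by linarith)] at heq
      have h3 : 2 * t - 1 = 1 - 2 * s := by linarith
      rw [h3] at heq
      have h4 := smul_right_injective ℂ (r := 1 - 2 * s) (by intro h0; linarith) (add_left_cancel heq)
      exact hfix y (sub_left_injective h4).symm
  refine ⟨a, by fun_prop, by rw [a0, a1], by rw [al _ le_rfl]; norm_num, ?_, ?_⟩
  · intro s _ t _ heq
    rcases lt_trichotomy s t with h | h | h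
    · exact absurd heq (hneq s t h)
    · exact h
    · exact absurd heq.symm (hneq t s h)
  · intro s hs t ht heq
    by_cases ht0 : t = 0
    · by_cases hs0 : s = 0
      · rw [ht0, hs0] at heq; exact hfix _ heq
      · have := hlt s hs hs0
        rw [← heq, ht0, a0, hfy] at this
        exact lt_irrefl _ this
    · refine c1 _ (hlt t ht ht0) ?_
      rw [heq, hd]
      have : |1 - 2 * s| ≤ 1 := by rw [abs_le]; constructor <;> linarith [hs.1, hs.2]
      nlinarith

lemma noPer_all (n : ℕ) : 1 ≤ n → NoPer n := by
  induction n using Nat.strong_induction_on with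
  | _ n ih =>
  intro hn1 f hf hfix x hx
  have hP : ∀ m, 1 ≤ m → m < n → NoPer m := fun m h1 h2 => ih m h2 h1
  rcases (by omega : n = 1 ∨ n = 2 ∨ 3 ≤ n) with rfl | rfl | hn
  · exact hfix x hx
  · exact no_period_two hf f.continuous hfix x hx
  obtain ⟨a, hac, ha1, hax, hainj, hafree⟩ := exists_arc f hfix x
  have ha2 := reduction n hP f hf hfix a hac hafree 2 (by norm_num) (by omega)
  obtain ⟨γ, hγ, hγa, hγs⟩ := extend f f.continuous a hac ha1 (n + 1)
  have hn' : (3:ℝ) ≤ n := by exact_mod_cast hn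
  push_cast at hγs
  -- basic facts on `γ`
  have hfree1 : ∀ s ∈ Ico (1/2:ℝ) (3/2), ∀ t ∈ Ico (1/2:ℝ) (3/2), f (γ t) ≠ γ s := by
    rintro s ⟨hs1, hs2⟩ t ⟨ht1, ht2⟩ heq
    have hback : ∀ u : ℝ, 1 ≤ u → u < 3/2 → γ u = f (a (u - 1)) := by
      intro u hu1 hu2
      rw [← hγa (u-1) (by linarith), ← hγs (u - 1) ⟨by linarith, by linarith⟩]; simp
    rcases lt_or_ge s 1 with hs | hs <;> rcases lt_or_ge t 1 with ht | ht
    · rw [hγa s hs.le, hγa t ht.le] at heq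
      exact hafree s ⟨by linarith, hs⟩ t ⟨by linarith, ht⟩ heq
    · rw [hγa s hs.le, hback t ht ht2] at heq
      exact ha2 s ⟨by linarith, hs⟩ (t-1) ⟨by linarith, by linarith⟩ heq
    · rw [hback s hs hs2, hγa t ht.le] at heq
      have := hainj t ⟨by linarith, ht⟩ (s-1) ⟨by linarith, by linarith⟩ (f.injective heq)
      linarith
    · rw [hback s hs hs2, hback t ht ht2] at heq
      exact hafree (s-1) ⟨by linarith, by linarith⟩ (t-1) ⟨by linarith, by linarith⟩ (f.injective heq)
  have hinj1 : ∀ s ∈ Ico (1/2:ℝ) (3/2), ∀ t ∈ Ico (1/2:ℝ) (3/2), s < t → γ s ≠ γ t := by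
    rintro s ⟨hs1, hs2⟩ t ⟨ht1, ht2⟩ hst heq
    have hback : ∀ u : ℝ, 1 ≤ u → u < 3/2 → γ u = f (a (u - 1)) := by
      intro u hu1 hu2
      rw [← hγa (u-1) (by linarith), ← hγs (u - 1) ⟨by linarith, by linarith⟩]; simp
    rcases lt_or_ge t 1 with ht | ht
    · rw [hγa s (by linarith), hγa t ht.le] at heq
      have := hainj s ⟨by linarith, by linarith⟩ t ⟨by linarith, ht⟩ heq
      linarith
    · rw [hback t ht ht2] at heq
      rcases lt_or_ge s 1 with hs | hs
      · rw [hγa s hs.le] at heq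
        exact hafree s ⟨by linarith, hs⟩ (t-1) ⟨by linarith, by linarith⟩ heq.symm
      · rw [hback s hs hs2] at heq
        have := hainj (s-1) ⟨by linarith, by linarith⟩ (t-1) ⟨by linarith, by linarith⟩
          (f.injective heq)
        linarith
  let α : ℝ → ℂ := fun t => γ (t + 1/2)
  have hαc : Continuous α := by fun_prop
  have hα0 : α 0 = x := by
    simp only [α, zero_add]; rw [hγa _ (by norm_num), hax]
  have hαs : ∀ t ∈ Icc (0:ℝ) n, α (t + 1) = f (α t) := by
    rintro t ⟨h0, h1⟩
    simp only [α]
    rw [← hγs _ ⟨by linarith, by linarith⟩]; congr 1; ring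
  have hαfree := reduction n hP f hf hfix α hαc (fun s hs t ht =>
    hfree1 _ ⟨by linarith [hs.1], by linarith [hs.2]⟩ _ ⟨by linarith [ht.1], by linarith [ht.2]⟩)
  have hαinj : ∀ s ∈ Ico (0:ℝ) 1, ∀ t ∈ Ico (0:ℝ) 1, s < t → α s ≠ α t := fun s hs t ht hst =>
    hinj1 _ ⟨by linarith [hs.1], by linarith [hs.2]⟩ _ ⟨by linarith [ht.1], by linarith [ht.2]⟩
      (by linarith)
  have hαit : ∀ j : ℕ, j ≤ n → ∀ t ∈ Ico (0:ℝ) 1, α (t + j) = f^[j] (α t) := by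
    intro j
    induction j with
    | zero => intro _ t _; simp
    | succ j ihj =>
      intro hj t ht
      have hj' : (j:ℝ) + 1 ≤ n := by exact_mod_cast hj
      rw [iterate_succ_apply', ← ihj (by omega) t ht, ← hαs _ ⟨by linarith [ht.1, (Nat.cast_nonneg j : (0:ℝ) ≤ j)], by linarith [ht.2]⟩]
      congr 1; push_cast; ring
  have hαn : α n = α 0 := by
    have := hαit n le_rfl 0 ⟨le_rfl, one_pos⟩
    rw [zero_add] at this
    rw [this, hα0, hx]
  have hlt : ∀ s t : ℝ, 0 ≤ s → s < t → t < n → α s ≠ α t := by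
    intro s t hs hst htn heq
    have ht : 0 ≤ t := by linarith
    have key : ∀ u : ℝ, 0 ≤ u → u < n → α u = f^[⌊u⌋₊] (α (u - ⌊u⌋₊)) ∧ u - ⌊u⌋₊ ∈ Ico (0:ℝ) 1 := by
      intro u hu hun
      have h1 := Nat.floor_le hu
      have h2 := Nat.lt_floor_add_one u
      have hm : u - ⌊u⌋₊ ∈ Ico (0:ℝ) 1 := ⟨by linarith, by linarith⟩
      refine ⟨?_, hm⟩
      rw [← hαit _ ((Nat.floor_lt hu).2 hun).le _ hm]; simp
    obtain ⟨k1, k2⟩ := key s hs (by linarith)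
    obtain ⟨k3, k4⟩ := key t ht htn
    have hfl : ⌊s⌋₊ ≤ ⌊t⌋₊ := Nat.floor_le_floor hst.le
    have hfn : ⌊t⌋₊ < n := (Nat.floor_lt ht).2 htn
    obtain ⟨d, hd⟩ := Nat.exists_eq_add_of_le hfl
    rw [k1, k3] at heq
    have heq2 : α (s - ⌊s⌋₊) = f^[d] (α (t - ⌊t⌋₊)) := by
      apply f.injective.iterate ⌊s⌋₊
      rw [heq, ← iterate_add_apply, ← hd]
    rcases Nat.eq_zero_or_pos d with rfl | hdpos
    · refine hαinj _ k2 _ k4 ?_ heq2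
      have : ⌊t⌋₊ = ⌊s⌋₊ := by simpa using hd
      rw [this]; linarith
    · exact hαfree d hdpos (by omega) _ k2 _ k4 heq2.symm
  refine no_simple_loop hf f.continuous hfix n (by linarith) α hαc
    (fun t ht => hαs t ⟨ht.1, by linarith [ht.2]⟩) hαn ?_
  intro s t hs hst htn hor
  rcases htn.lt_or_eq with h | h
  · exact hlt s t hs hst h
  · subst h
    have hs0 : 0 < s := by rcases hor with h | h <;> linarith
    rw [hαn]
    exact (hlt 0 s le_rfl hs0 hst).symm

lemma multi_push {ι : Type*} [DecidableEq ι] (V C : ι → Set ℂ) (hV : ∀ i, IsOpen (V i))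
    (hd : ∀ i j, i ≠ j → Disjoint (V i) (V j)) (hC : ∀ i, IsPreconnected (C i))
    (hCV : ∀ i, C i ⊆ V i) (q p : ι → ℂ) (hq : ∀ i, q i ∈ C i) (hp : ∀ i, p i ∈ C i)
    (S : Finset ι) : ∃ g : ℂ ≃ₜ ℂ, PIso g ∧ (∀ z, (∀ i ∈ S, z ∉ V i) → g z = z) ∧
      (∀ i ∈ S, ∀ z ∈ V i, g z ∈ V i) ∧ ∀ i ∈ S, g (q i) = p i := by
  induction S using Finset.induction_on with
  | empty => exact ⟨Homeomorph.refl ℂ, PIso.id, fun _ _ => rfl, by simp, by simp⟩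
  | insert i S hi ih =>
    obtain ⟨g, g1, g2, g3, g4⟩ := ih
    obtain ⟨k, k1, k2, k3⟩ := push (hV i) (hC i) (hCV i) (hq i) (hp i)
    have gi : ∀ z ∈ V i, g z = z := fun z hz => g2 z fun j hj hzj =>
      Set.disjoint_left.1 (hd i j (by rintro rfl; exact hi hj)) hz hzj
    have kj : ∀ j ∈ S, ∀ z ∈ V j, k z = z := fun j hj z hz => k2 z fun hzi =>
      Set.disjoint_left.1 (hd i j (by rintro rfl; exact hi hj)) hzi hz
    refine ⟨g.trans k, k1.comp g1, ?_, ?_, ?_⟩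
    · intro z hz
      rw [Homeomorph.trans_apply, g2 z fun j hj => hz j (Finset.mem_insert_of_mem hj),
        k2 z (hz i (Finset.mem_insert_self _ _))]
    · intro j hj z hz
      rw [Homeomorph.trans_apply]
      rcases Finset.mem_insert.1 hj with rfl | hj
      · rw [gi z hz]; exact push_mem k2 hz
      · rw [kj j hj _ (g3 j hj z hz)]; exact g3 j hj z hz
    · intro j hj
      rw [Homeomorph.trans_apply]
      rcases Finset.mem_insert.1 hj with rfl | hj
      · rw [gi _ (hCV _ (hq _)), k3]
      · rw [g4 j hj, kj j hj _ (hCV _ (hp _))]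

lemma no_chain (h : ℂ ≃ₜ ℂ) (hiso : PIso h) (hfix : ∀ z, h z ≠ z) (n : ℕ)
    (C : Fin (n + 1) → Set ℂ) (hcl : ∀ i, IsClosed (C i)) (hC : ∀ i, IsPreconnected (C i))
    (hd : ∀ i j, i ≠ j → Disjoint (C i) (C j)) (hfree : ∀ i, Disjoint (C i) (h '' C i))
    (hmeet : ∀ i, (h '' C i ∩ C (i + 1)).Nonempty) : False := by
  have sep1 : ∀ i j, ∃ U : Set ℂ × Set ℂ, i ≠ j → IsOpen U.1 ∧ IsOpen U.2 ∧ C i ⊆ U.1 ∧ C j ⊆ U.2 ∧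
      Disjoint U.1 U.2 := by
    intro i j
    by_cases hij : i = j
    · exact ⟨(∅, ∅), fun h => absurd hij h⟩
    · obtain ⟨A, B, h1, h2, h3, h4, h5⟩ := normal_separation (hcl i) (hcl j) (hd i j hij)
      exact ⟨(A, B), fun _ => ⟨h1, h2, h3, h4, h5⟩⟩
  choose U hU using sep1
  have sep2 : ∀ i, ∃ A B : Set ℂ, IsOpen A ∧ IsOpen B ∧ C i ⊆ A ∧ h '' C i ⊆ B ∧ Disjoint A B := by
    intro i
    exact normal_separation (hcl i) (h.isClosedMap _ (hcl i)) (hfree i)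
  choose A B hA hB hCA hCB hAB using sep2
  let V : Fin (n+1) → Set ℂ := fun i => (A i ∩ h ⁻¹' (B i)) ∩
    ⋂ j, ({z | i ≠ j → z ∈ (U i j).1} ∩ {z | i ≠ j → z ∈ (U j i).2})
  have hV : ∀ i, IsOpen (V i) := by
    intro i
    refine ((hA i).inter ((hB i).preimage h.continuous)).inter (isOpen_iInter_of_finite fun j => ?_)
    by_cases hij : i = j
    · simp [hij]
    · simpa [hij] using (hU i j hij).1.inter (hU j i (Ne.symm hij)).2.1
  have hCV : ∀ i, C i ⊆ V i := by
    intro i z hz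
    refine ⟨⟨hCA i hz, hCB i ⟨z, hz, rfl⟩⟩, mem_iInter.2 fun j => ⟨fun hij => ?_, fun hij => ?_⟩⟩
    · exact (hU i j hij).2.2.1 hz
    · exact (hU j i (Ne.symm hij)).2.2.2.1 hz
  have hVd : ∀ i j, i ≠ j → Disjoint (V i) (V j) := by
    intro i j hij
    rw [Set.disjoint_left]
    intro z hz hz'
    exact Set.disjoint_left.1 (hU i j hij).2.2.2.2 ((mem_iInter.1 hz.2 j).1 hij)
      ((mem_iInter.1 hz'.2 i).2 (Ne.symm hij))
  have hex : ∀ i, ∃ p, p ∈ C i ∧ h p ∈ C (i + 1) := by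
    intro i
    obtain ⟨_, ⟨p, hp, rfl⟩, hp'⟩ := hmeet i
    exact ⟨p, hp, hp'⟩
  choose p hp hp' using hex
  obtain ⟨g, g1, g2, g3, g4⟩ := multi_push V C hV hVd hC hCV (fun i => h (p (i - 1))) p
    (fun i => by simpa using hp' (i - 1)) hp Finset.univ
  have hstep : ∀ i, (h.trans g) (p i) = p (i + 1) := by
    intro i
    have := g4 (i + 1) (Finset.mem_univ _)
    simpa using this
  have hit : ∀ (k : ℕ) i, (h.trans g)^[k] (p i) = p (i + k • (1 : Fin (n + 1))) := by
    intro k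
    induction k with
    | zero => intro i; simp
    | succ k ih => intro i; rw [iterate_succ_apply', ih, hstep, succ_nsmul, add_assoc]
  refine noPer_all (n + 1) (by omega) (h.trans g) (g1.comp hiso) ?_ (p 0) ?_
  · intro z hz
    rw [Homeomorph.trans_apply] at hz
    by_cases hex : ∃ i, h z ∈ V i
    · obtain ⟨i, hi⟩ := hex
      have := g3 i (Finset.mem_univ _) _ hi
      rw [hz] at this
      exact Set.disjoint_left.1 (hAB i) hi.1.1 this.1.2
    · rw [g2 _ fun i _ hi => hex ⟨i, hi⟩] at hz
      exact hfix z hz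
  · have h0 : (n + 1) • (1 : Fin (n + 1)) = 0 := by
      simpa using card_nsmul_eq_zero (x := (1 : Fin (n + 1)))
    rw [hit, h0, add_zero]

/-- Le Roux–Guillou / Franks: A fixed-point-free homeomorphism of
the plane isotopic to the identity admits no periodic free chain of disks:
there is no cyclic family `D₀, …, D_n` of nonempty open connected sets with
pairwise disjoint closures, each closure free, with `h(closure Dᵢ)` meeting
`closure D_{i+1 mod (n+1)}` for every `i`. -/
theorem no_periodic_free_chain_of_disks
    (h : (ℝ × ℝ) ≃ₜ (ℝ × ℝ))
    (hiso : ∃ H : ℝ → (ℝ × ℝ) → (ℝ × ℝ),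
      Continuous (fun p : ℝ × (ℝ × ℝ) => H p.1 p.2) ∧
      (∀ t ∈ Set.Icc (0:ℝ) 1, ∃ e : (ℝ × ℝ) ≃ₜ (ℝ × ℝ), ⇑e = H t) ∧
      H 0 = id ∧ H 1 = ⇑h)
    (hfree : ∀ z : ℝ × ℝ, h z ≠ z) :
    ¬ ∃ (n : ℕ) (D : Fin (n + 1) → Set (ℝ × ℝ)),
      (∀ i, (D i).Nonempty ∧ IsOpen (D i) ∧ IsConnected (D i)) ∧
      (∀ i j, i ≠ j → closure (D i) ∩ closure (D j) = ∅) ∧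
      (∀ i, h '' closure (D i) ∩ closure (D i) = ∅) ∧
      (∀ i, (h '' closure (D i) ∩ closure (D (i + 1))).Nonempty) := by
  rintro ⟨n, D, hD, hdis, hfr, hmeet⟩
  let e : ℂ ≃ₜ ℝ × ℝ := Complex.equivRealProdCLM.toHomeomorph
  refine no_chain (e.trans (h.trans e.symm)) ?_ ?_ n (fun i => e.symm '' closure (D i)) ?_ ?_ ?_ ?_ ?_
  · obtain ⟨H, h1, h2, h3, h4⟩ := hiso
    refine ⟨fun t z => e.symm (H t (e z)), ?_, ?_, ?_, ?_⟩
    · exact e.symm.continuous.comp (h1.comp (continuous_fst.prodMk (e.continuous.comp continuous_snd)))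
    · intro t ht
      obtain ⟨k, hk⟩ := h2 t ht
      simp only [← hk]
      exact e.symm.injective.comp (k.injective.comp e.injective)
    · ext1 z; simp [h3]
    · ext1 z; simp [h4]
  · intro z hz
    apply hfree (e z)
    apply e.symm.injective
    simpa using hz
  · exact fun i => e.symm.isClosedMap _ isClosed_closure
  · exact fun i => (hD i).2.2.isPreconnected.closure.image _ e.symm.continuous.continuousOn
  · intro i j hij
    exact (Set.disjoint_image_iff e.symm.injective).2 (Set.disjoint_iff_inter_eq_empty.2 (hdis i j hij))
  · intro i
    rw [Set.disjoint_left]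
    rintro _ ⟨u, hu, rfl⟩ ⟨_, ⟨v, hv, rfl⟩, hv'⟩
    have : h v = u := e.symm.injective (by simpa using hv')
    have hm : u ∈ h '' closure (D i) ∩ closure (D i) := ⟨⟨v, hv, this⟩, hu⟩
    rw [hfr i] at hm
    exact hm
  · intro i
    obtain ⟨_, ⟨v, hv, rfl⟩, hv'⟩ := hmeet i
    exact ⟨e.symm (h v), ⟨e.symm v, ⟨v, hv, rfl⟩, by simp⟩, ⟨h v, hv', rfl⟩⟩
end
end
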